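/- arXiv:2006.14449 — 10 statements merged into one kernel-verified Lean document; each statement's English description precedes it below -/
import Mathlib

section
/- Let q ≥ 1 be an integer, let A be a real symmetric positive semidefinite n×n matrix, and let P be a real orthogonal projection n×n matrix. Then tr[(AP)^q (PA)^q] ≤ tr[P A^{2q} P], where (AP)^q denotes the q-fold matrix product of AP. -/
open Matrix

lemma aux_jensen {n : ℕ} (w x : Fin n → ℝ) (hw : ∀ i, 0 ≤ w i) (hx : ∀ i, 0 ≤ x i)
    (hs : ∑ i, w i ≤ 1) (q : ℕ) (hq : 1 ≤ q) :
    (∑ i, w i * x i) ^ q ≤ ∑ i, w i * x i ^ q := by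
  have h := (convexOn_pow (𝕜 := ℝ) q).map_add_sum_le (t := Finset.univ) (w := w) (p := x)
    (v := 1 - ∑ i, w i) (q := 0) (fun i _ => hw i) (by ring) (fun i _ => hx i)
    (by linarith) (by simp)
  have h0 : q ≠ 0 := by omega
  simpa [h0] using h

lemma aux_scalar {n : ℕ} (w x : Fin n → ℝ) (hw : ∀ i, 0 ≤ w i) (hx : ∀ i, 0 ≤ x i)
    (hs : ∑ i, w i ≤ 1) (r : ℕ) :
    (∑ i, w i * x i) ^ (2 * r) * (∑ i, w i * x i ^ 2) ≤ ∑ i, w i * x i ^ (2 * (r + 1)) := by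
  have h1 := aux_jensen w x hw hx hs 2 (by norm_num)
  have h2 := aux_jensen w (fun i => x i ^ 2) hw (fun i => by positivity) hs (r + 1) (by omega)
  have h0 : 0 ≤ ∑ i, w i * x i ^ 2 :=
    Finset.sum_nonneg fun i _ => mul_nonneg (hw i) (by positivity)
  simp only [pow_mul]
  calc _ ≤ (∑ i, w i * x i ^ 2) ^ r * (∑ i, w i * x i ^ 2) := by
        gcongr
    _ ≤ _ := by rw [← pow_succ]; exact h2

lemma aux_diag {n : ℕ} (W : Matrix (Fin n) (Fin n) ℝ) (d : Fin n → ℝ) (i : Fin n) :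
    (Wᵀ * diagonal d * W) i i = ∑ j, W j i ^ 2 * d j := by
  rw [Matrix.mul_apply]
  refine Finset.sum_congr rfl fun j _ => ?_
  rw [Matrix.mul_diagonal, transpose_apply]; ring

lemma aux_spec {n : ℕ} (A : Matrix (Fin n) (Fin n) ℝ) (hA : A.IsHermitian) :
    ∃ U : Matrix (Fin n) (Fin n) ℝ, Uᵀ * U = 1 ∧ U * Uᵀ = 1 ∧
      ∀ k : ℕ, A ^ k = U * diagonal (fun i => hA.eigenvalues i ^ k) * Uᵀ := by
  obtain ⟨U, h1, h2, h3⟩ : ∃ U : Matrix (Fin n) (Fin n) ℝ, Uᵀ * U = 1 ∧ U * Uᵀ = 1 ∧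
      A = U * diagonal hA.eigenvalues * Uᵀ := by
    refine ⟨hA.eigenvectorUnitary, ?_, ?_, ?_⟩
    · simpa [star_eq_conjTranspose] using (Unitary.coe_star_mul_self hA.eigenvectorUnitary)
    · simpa [star_eq_conjTranspose] using (Unitary.coe_mul_star_self hA.eigenvectorUnitary)
    · have := hA.spectral_theorem
      simpa [Unitary.conjStarAlgAut_apply, star_eq_conjTranspose, Function.comp_def] using this
  generalize hA.eigenvalues = d at h3 ⊢
  refine ⟨U, h1, h2, fun k => ?_⟩
  induction k with
  | zero => simp [h2]
  | succ k ih =>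
    rw [pow_succ, ih]
    conv_lhs => rw [h3]
    have : U * diagonal (fun i => d i ^ k) * Uᵀ * (U * diagonal d * Uᵀ)
      = U * diagonal (fun i => d i ^ k) * (Uᵀ * U) * diagonal d * Uᵀ := by
      simp only [Matrix.mul_assoc]
    rw [this, h1, Matrix.mul_one, Matrix.mul_assoc U, diagonal_mul_diagonal]
    simp only [pow_succ]

/-- For an integer `q ≥ 1`, a real symmetric positive semidefinite `n × n`
matrix `A`, and a real orthogonal projection matrix `P` (symmetric with `P * P = P`),
we have `tr[(AP)^q (PA)^q] ≤ tr[P A^{2q} P]`. -/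
theorem stmt_0 {n : ℕ} (q : ℕ) (hq : 1 ≤ q)
    (A P : Matrix (Fin n) (Fin n) ℝ)
    (hA : A.PosSemidef)
    (hP : P.IsSymm) (hP2 : P * P = P) :
    ((A * P) ^ q * (P * A) ^ q).trace ≤ (P * A ^ (2 * q) * P).trace := by
  obtain ⟨r, rfl⟩ : ∃ r, q = r + 1 := ⟨q - 1, by omega⟩
  have hPt : Pᵀ = P := hP
  have hAt : Aᵀ = A := by simpa [IsHermitian] using hA.1
  have hC : (P * A * P).IsHermitian := by
    simp [IsHermitian, hPt, hAt, Matrix.mul_assoc]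
  obtain ⟨U, hU1, hU2, hU⟩ := aux_spec A hA.1
  obtain ⟨V, hV1, hV2, hV⟩ := aux_spec (P * A * P) hC
  have hd := hA.eigenvalues_nonneg
  set d := hA.1.eigenvalues
  set e := hC.eigenvalues
  set W := Uᵀ * P * V with hW
  have hWt : Wᵀ = Vᵀ * P * U := by simp [hW, hPt, Matrix.mul_assoc]
  have key : ∀ k : ℕ, Vᵀ * (P * A ^ k * P) * V = Wᵀ * diagonal (fun i => d i ^ k) * W := by
    intro k; rw [hU k, hWt, hW]; simp only [Matrix.mul_assoc]
  have tr : ∀ M : Matrix (Fin n) (Fin n) ℝ, M.trace = (Vᵀ * M * V).trace := by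
    intro M; rw [trace_mul_comm, ← Matrix.mul_assoc, hV2, Matrix.one_mul]
  -- eigenvalues of the compression
  have he : ∀ i, e i = ∑ j, W j i ^ 2 * d j := by
    intro i
    have h1 := key 1
    have h2 := hV 1
    simp only [pow_one] at h1 h2
    rw [← aux_diag, ← h1, h2]
    have : Vᵀ * (V * diagonal e * Vᵀ) * V = (Vᵀ * V) * diagonal e * (Vᵀ * V) := by
      simp only [Matrix.mul_assoc]
    rw [this, hV1]; simp
  have hs : ∀ i, ∑ j, W j i ^ 2 ≤ 1 := by
    intro i
    have h0 := aux_diag W (fun _ => 1) i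
    have h1 := aux_diag ((1 - P) * V) (fun _ => 1) i
    have hsum : Wᵀ * diagonal (fun _ => 1) * W
        + ((1 - P) * V)ᵀ * diagonal (fun _ => 1) * ((1 - P) * V) = 1 := by
      have e1 : Wᵀ * W = Vᵀ * P * V := by
        have : Wᵀ * W = Vᵀ * (P * (U * Uᵀ) * P) * V := by
          rw [hWt, hW]; simp only [Matrix.mul_assoc]
        rw [this, hU2, Matrix.mul_one, hP2]
      have e2 : ((1 - P) * V)ᵀ * ((1 - P) * V) = Vᵀ * (1 - P) * V := by
        have : ((1 - P) * V)ᵀ * ((1 - P) * V) = Vᵀ * ((1 - P) * (1 - P)) * V := by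
          simp only [transpose_mul, transpose_sub, transpose_one, hPt, Matrix.mul_assoc]
        rw [this]; congr 2; simp [mul_sub, sub_mul, hP2]
      rw [diagonal_one, Matrix.mul_one, Matrix.mul_one, e1, e2, ← Matrix.add_mul, ← Matrix.mul_add,
        add_sub_cancel, Matrix.mul_one, hV1]
    have h2 := congrFun (congrFun hsum i) i
    rw [Matrix.add_apply, h0, h1, one_apply_eq] at h2
    simp only [mul_one] at h2
    have : 0 ≤ ∑ j, ((1 - P) * V) j i ^ 2 := Finset.sum_nonneg fun j _ => sq_nonneg _
    linarith
  have hR : (P * A ^ (2 * (r + 1)) * P).trace = ∑ i, ∑ j, W j i ^ 2 * d j ^ (2 * (r + 1)) := by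
    rw [tr, key]; exact Finset.sum_congr rfl fun i _ => aux_diag _ _ _
  have hL : ((A * P) ^ (r + 1) * (P * A) ^ (r + 1)).trace
      = ∑ i, e i ^ (2 * r) * ∑ j, W j i ^ 2 * d j ^ 2 := by
    have hcomm : Commute P (P * A * P) := by
      change P * (P * A * P) = P * A * P * P
      rw [Matrix.mul_assoc (P * A), hP2, ← Matrix.mul_assoc, ← Matrix.mul_assoc, hP2]
    have hX : ∀ k : ℕ, P * (A * P) ^ k = P * (P * A * P) ^ k := by
      intro k
      induction k with
      | zero => simp
      | succ k ih =>
        rw [pow_succ, ← Matrix.mul_assoc, ih, (hcomm.pow_right k).eq, pow_succ,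
          ← Matrix.mul_assoc P, (hcomm.pow_right k).eq]
        have : (P * A * P) ^ k * P * (P * A * P) = (P * A * P) ^ k * (P * P) * A * P := by
          simp only [Matrix.mul_assoc]
        rw [this, hP2]; simp only [Matrix.mul_assoc]
    have hX1 : (A * P) ^ (r + 1) = A * (P * (P * A * P) ^ r) := by
      rw [pow_succ', Matrix.mul_assoc, hX]
    have hX2 : (P * A) ^ (r + 1) = (P * A * P) ^ r * P * A := by
      have : (P * A) ^ (r + 1) = ((A * P) ^ (r + 1))ᵀ := by
        rw [transpose_pow, transpose_mul, hPt, hAt]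
      have hCt : (P * A * P)ᵀ = P * A * P := by simp [hPt, hAt, Matrix.mul_assoc]
      rw [this, hX1, transpose_mul, transpose_mul, transpose_pow, hCt, hPt, hAt]
    have h1 : ((A * P) ^ (r + 1) * (P * A) ^ (r + 1)).trace
        = ((P * A ^ 2 * P) * (P * A * P) ^ (2 * r)).trace := by
      rw [trace_mul_comm, hX1, hX2, two_mul, pow_add]
      have : (P * A * P) ^ r * P * A * (A * (P * (P * A * P) ^ r))
        = (P * A * P) ^ r * (P * A ^ 2 * P * (P * A * P) ^ r) := by
        rw [pow_two]; simp only [Matrix.mul_assoc]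
      rw [this, trace_mul_comm]; simp only [Matrix.mul_assoc]
    rw [h1, tr]
    have h2 : Vᵀ * ((P * A ^ 2 * P) * (P * A * P) ^ (2 * r)) * V
        = (Wᵀ * diagonal (fun i => d i ^ 2) * W) * diagonal (fun i => e i ^ (2 * r)) := by
      rw [← key, hV (2 * r)]
      have : Vᵀ * ((P * A ^ 2 * P) * (V * diagonal (fun i => e i ^ (2 * r)) * Vᵀ)) * V
        = Vᵀ * (P * A ^ 2 * P) * V * diagonal (fun i => e i ^ (2 * r)) * (Vᵀ * V) := by
        simp only [Matrix.mul_assoc]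
      rw [this, hV1, Matrix.mul_one]
    rw [h2]
    refine Finset.sum_congr rfl fun i _ => ?_
    rw [diag_apply, Matrix.mul_diagonal, aux_diag, mul_comm]
  rw [hL, hR]
  refine Finset.sum_le_sum fun i _ => ?_
  rw [he i]
  exact aux_scalar (fun j => W j i ^ 2) d (fun j => sq_nonneg _) hd (hs i) r
end

section
/- Let E_W be a finite index set, let L_G and L_e (e ∈ E_W) be real symmetric n×n matrices, let Δ > 0, γ, k be reals, let Z be a real symmetric n×n matrix, v ∈ ℝ, and β ∈ ℝ^{E_W}. Define B = {e ∈ E_W : v + β_e < L_e•Z}, T = Δ·(Z•P_⊥), T_tot = L_G•Z + k·v + Σ_{e∈E_W} β_e, and Γ = Σ_{e∈B}(L_e•Z − v − β_e). Assume T > 0 and Γ ≤ T·γ − T_tot. Define Z' = Z/T, v' = v/T, β'_e = β_e/T for e ∉ B and β'_e = (L_e•Z − v)/T for e ∈ B. Then Z'•(Δ P_⊥) = 1, Z'•L_e ≤ v' + β'_e for every e ∈ E_W, and Z'•L_G + k·v' + Σ_{e∈E_W} β'_e ≤ γ. -/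
open Matrix

/-- `Pbot n` is the matrix `P_⊥ = I − (1/n) 𝟙 𝟙ᵀ`, the orthogonal projection onto the
orthogonal complement of the all-ones vector in `ℝ^n`. -/
noncomputable def Pbot (n : ℕ) : Matrix (Fin n) (Fin n) ℝ :=
  1 - (n : ℝ)⁻¹ • Matrix.of (fun _ _ => (1 : ℝ))

/-- The Frobenius inner product `A • B = Σ_{i,j} A_{ij} B_{ij} = tr(Aᵀ B)`. -/
def mip {n : ℕ} (A B : Matrix (Fin n) (Fin n) ℝ) : ℝ := (Aᵀ * B).trace

/-- (When the oracle fails, the rescaled triple is dual feasible.)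
With `B = {e : v + β_e < L_e • Z}`, `T = Δ (Z • P_⊥) > 0`,
`T_tot = L_G • Z + k v + Σ_e β_e`, `Γ = Σ_{e ∈ B} (L_e • Z − v − β_e)`, and assuming
`Γ ≤ T γ − T_tot`, the rescaled triple `Z' = Z/T`, `v' = v/T`,
`β'_e = (L_e • Z − v)/T` for `e ∈ B` and `β'_e = β_e/T` otherwise, satisfies
`Z' • (Δ P_⊥) = 1`, `Z' • L_e ≤ v' + β'_e` for every `e`, and
`Z' • L_G + k v' + Σ_e β'_e ≤ γ`. -/
theorem stmt_4 {n : ℕ} {E : Type*} [Fintype E] [DecidableEq E]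
    (LG : Matrix (Fin n) (Fin n) ℝ) (hLG : LG.IsSymm)
    (Le : E → Matrix (Fin n) (Fin n) ℝ) (hLe : ∀ e, (Le e).IsSymm)
    (Δ γ k : ℝ) (hΔ : 0 < Δ)
    (Z : Matrix (Fin n) (Fin n) ℝ) (hZ : Z.IsSymm)
    (v : ℝ) (β : E → ℝ)
    (Bs : Finset E) (hBs : ∀ e, e ∈ Bs ↔ v + β e < mip (Le e) Z)
    (T : ℝ) (hT : T = Δ * mip Z (Pbot n)) (hTpos : 0 < T)
    (Ttot : ℝ) (hTtot : Ttot = mip LG Z + k * v + ∑ e, β e)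
    (Γ : ℝ) (hΓ : Γ = ∑ e ∈ Bs, (mip (Le e) Z - v - β e))
    (hfail : Γ ≤ T * γ - Ttot) :
    mip (T⁻¹ • Z) (Δ • Pbot n) = 1 ∧
    (∀ e, mip (T⁻¹ • Z) (Le e) ≤
        v / T + (if e ∈ Bs then (mip (Le e) Z - v) / T else β e / T)) ∧
    mip (T⁻¹ • Z) LG + k * (v / T) +
        ∑ e, (if e ∈ Bs then (mip (Le e) Z - v) / T else β e / T) ≤ γ := by
  have hcomm : ∀ A B : Matrix (Fin n) (Fin n) ℝ, mip A B = mip B A := by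
    intro A B
    unfold mip
    rw [← Matrix.trace_transpose, Matrix.transpose_mul, Matrix.transpose_transpose]
  have hsm : ∀ (c : ℝ) (A B : Matrix (Fin n) (Fin n) ℝ), mip (c • A) B = c * mip A B := by
    intro c A B
    simp [mip]
  have hT0 : T ≠ 0 := hTpos.ne'
  refine ⟨?_, ?_, ?_⟩
  · rw [hsm, hcomm, hsm, hcomm, ← hT]
    exact inv_mul_cancel₀ hT0
  · intro e
    rw [hsm, hcomm, inv_mul_eq_div]
    split_ifs with h
    · rw [← add_div]
      apply le_of_eq
      ring
    · rw [← add_div]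
      rw [hBs, not_lt] at h
      exact div_le_div_of_nonneg_right h hTpos.le
  · have hs : ∑ e, (if e ∈ Bs then (mip (Le e) Z - v) / T else β e / T)
        = (∑ e, β e + Γ) / T := by
      have h1 : Γ = ∑ e, (if e ∈ Bs then (mip (Le e) Z - v - β e) else 0) := by
        rw [hΓ, Finset.sum_ite_mem, Finset.univ_inter]
      rw [h1, ← Finset.sum_add_distrib, Finset.sum_div]
      refine Finset.sum_congr rfl fun e _ => ?_
      split_ifs <;> ring
    rw [hs, hsm, hcomm]
    have : T⁻¹ * mip LG Z + k * (v / T) + (∑ e, β e + Γ) / T = (Ttot + Γ) / T := by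
      rw [hTtot]
      ring
    rw [this, div_le_iff₀ hTpos]
    linarith
end

section
/- Let G = (V,E) be an undirected weighted graph with nonnegative weights and let W = (V,E_W) be an unweighted graph on the same n vertices with |E_W| = m, and suppose that the (weighted) degree of every vertex in each of G and W is at most Δ > 0. Let δ ≥ 0, k ∈ ℝ, λ̄ ∈ ℝ and w̄ ∈ ℝ^{E_W} satisfy: (i) L_G + Σ_{e∈E_W} w̄_e L_e − λ̄ Δ P_⊥ ⪰ −δ Δ P_⊥; (ii) k − Σ_{e∈E_W} w̄_e ≥ −δ m; (iii) 1 − w̄_e ≥ −δ for every e ∈ E_W. Then: L_G + Σ_{e∈E_W}(w̄_e − δ) L_e − (λ̄ − 3δ) Δ P_⊥ ⪰ 0, k − Σ_{e∈E_W}(w̄_e − δ) ≥ 0, and 1 − (w̄_e − δ) ≥ 0 for every e ∈ E_W. -/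
open Matrix

/-- For an edge `e = (u, v)`, the vector `b_e ∈ ℝ^n` with `b_e(u) = 1`, `b_e(v) = −1`
and `0` elsewhere. -/
noncomputable def edgeVec {n : ℕ} (e : Fin n × Fin n) : Fin n → ℝ :=
  Pi.single e.1 1 - Pi.single e.2 1

/-- The Laplacian `L_e = b_e b_eᵀ` of a single edge `e`. -/
noncomputable def edgeLap {n : ℕ} (e : Fin n × Fin n) : Matrix (Fin n) (Fin n) ℝ :=
  Matrix.vecMulVec (edgeVec e) (edgeVec e)

lemma aux_quad_edge {n : ℕ} (e : Fin n × Fin n) (x : Fin n → ℝ) :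
    x ⬝ᵥ (edgeLap e *ᵥ x) = (x e.1 - x e.2) ^ 2 := by
  have h : edgeVec e ⬝ᵥ x = x e.1 - x e.2 := by
    simp [edgeVec, sub_dotProduct]
  rw [edgeLap, vecMulVec_mulVec, h, dotProduct_smul, dotProduct_comm, h]
  simp [pow_two]

lemma aux_quad_P {n : ℕ} (hn : 0 < n) (x : Fin n → ℝ) :
    x ⬝ᵥ (Pbot n *ᵥ x) = ∑ u, (x u - (n : ℝ)⁻¹ * ∑ v, x v) ^ 2 := by
  have hn' : (n : ℝ) ≠ 0 := by positivity
  have h : (Matrix.of (fun _ _ => (1 : ℝ)) : Matrix (Fin n) (Fin n) ℝ) *ᵥ x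
      = fun _ => ∑ v, x v := by
    ext i
    simp [mulVec, dotProduct]
  rw [Pbot, sub_mulVec, one_mulVec, smul_mulVec, h]
  simp only [dotProduct, Pi.sub_apply, Pi.smul_apply, smul_eq_mul]
  generalize hS : ∑ v, x v = S
  have e1 : ∀ u, x u * (x u - (n : ℝ)⁻¹ * S) = x u ^ 2 - x u * ((n : ℝ)⁻¹ * S) := by
    intro u; ring
  have e2 : ∀ u, (x u - (n : ℝ)⁻¹ * S) ^ 2
      = x u ^ 2 - x u * (2 * ((n : ℝ)⁻¹ * S)) + ((n : ℝ)⁻¹ * S) ^ 2 := by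
    intro u; ring
  simp only [e1, e2, Finset.sum_add_distrib, Finset.sum_sub_distrib, ← Finset.sum_mul, hS,
    Finset.sum_const, Finset.card_univ, Fintype.card_fin, nsmul_eq_mul]
  field_simp
  ring

lemma aux_deg {n : ℕ} (EW : Finset (Fin n × Fin n)) (hEW : ∀ e ∈ EW, e.1 ≠ e.2)
    (Δ : ℝ) (hdegW : ∀ u : Fin n,
      ((EW.filter (fun e => e.1 = u ∨ e.2 = u)).card : ℝ) ≤ Δ) (y : Fin n → ℝ) :
    ∑ e ∈ EW, (y e.1 - y e.2) ^ 2 ≤ 2 * Δ * ∑ u, y u ^ 2 := by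
  have h : ∑ e ∈ EW, (y e.1 ^ 2 + y e.2 ^ 2)
      = ∑ u, ((EW.filter (fun e => e.1 = u ∨ e.2 = u)).card : ℝ) * y u ^ 2 := by
    have : ∀ u, ((EW.filter (fun e => e.1 = u ∨ e.2 = u)).card : ℝ) * y u ^ 2
        = ∑ e ∈ EW, if e.1 = u ∨ e.2 = u then y u ^ 2 else 0 := by
      intro u
      rw [← Finset.sum_filter, Finset.sum_const, nsmul_eq_mul]
    simp only [this]
    rw [Finset.sum_comm]
    refine Finset.sum_congr rfl fun e he => ?_
    have hne := hEW e he
    have : ∀ u, (if e.1 = u ∨ e.2 = u then y u ^ 2 else 0)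
        = (if e.1 = u then y u ^ 2 else 0) + (if e.2 = u then y u ^ 2 else 0) := by
      intro u
      by_cases h1 : e.1 = u <;> by_cases h2 : e.2 = u <;> simp [h1, h2]
      exact absurd (h1.trans h2.symm) hne
    simp [this, Finset.sum_add_distrib]
  calc ∑ e ∈ EW, (y e.1 - y e.2) ^ 2 ≤ ∑ e ∈ EW, 2 * (y e.1 ^ 2 + y e.2 ^ 2) := by
        refine Finset.sum_le_sum fun e _ => ?_
        nlinarith [sq_nonneg (y e.1 + y e.2)]
    _ = 2 * ∑ u, ((EW.filter (fun e => e.1 = u ∨ e.2 = u)).card : ℝ) * y u ^ 2 := by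
        rw [← Finset.mul_sum, h]
    _ ≤ 2 * ∑ u, Δ * y u ^ 2 := by
        have := Finset.sum_le_sum (s := Finset.univ) fun u _ =>
          mul_le_mul_of_nonneg_right (hdegW u) (sq_nonneg (y u))
        linarith
    _ = _ := by rw [← Finset.mul_sum]; ring

lemma aux_psd {n : ℕ} (hn : 0 < n) (EW : Finset (Fin n × Fin n)) (hEW : ∀ e ∈ EW, e.1 ≠ e.2)
    (Δ : ℝ) (hdegW : ∀ u : Fin n,
      ((EW.filter (fun e => e.1 = u ∨ e.2 = u)).card : ℝ) ≤ Δ) :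
    ((2 * Δ) • Pbot n - ∑ e ∈ EW, edgeLap e).PosSemidef := by
  refine PosSemidef.of_dotProduct_mulVec_nonneg ?_ fun x => ?_
  · refine Matrix.ext fun i j => ?_
    simp [Pbot, edgeLap, Matrix.sum_apply, vecMulVec_apply, mul_comm, Matrix.one_apply, eq_comm]
  · have h := aux_deg EW hEW Δ hdegW (fun u => x u - (n : ℝ)⁻¹ * ∑ v, x v)
    simp only [sub_sub_sub_cancel_right] at h
    rw [star_trivial, sub_mulVec, dotProduct_sub, smul_mulVec, dotProduct_smul, aux_quad_P hn,
      sum_mulVec, dotProduct_sum]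
    simp only [aux_quad_edge, smul_eq_mul]
    linarith

/-- (Rounding step of the MWU theorem.) Let `G` be a weighted graph with
nonnegative symmetric weights `w` and weighted degrees at most `Δ > 0`, with Laplacian `L_G`,
and let `W` be an unweighted graph on the same `n` vertices with edge set `E_W`
(`m = |E_W|` edges, each with distinct endpoints), all of whose degrees are at most `Δ`.
If `δ ≥ 0`, `λ̄`, `k`, `w̄` satisfy
(i) `L_G + Σ_{e ∈ E_W} w̄_e L_e − λ̄ Δ P_⊥ ⪰ −δ Δ P_⊥`,
(ii) `k − Σ_e w̄_e ≥ −δ m`, and (iii) `1 − w̄_e ≥ −δ` for every `e ∈ E_W`, then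
`L_G + Σ_e (w̄_e − δ) L_e − (λ̄ − 3δ) Δ P_⊥ ⪰ 0`, `k − Σ_e (w̄_e − δ) ≥ 0`, and
`1 − (w̄_e − δ) ≥ 0` for every `e ∈ E_W`. -/
theorem stmt_6 {n : ℕ} (hn : 0 < n)
    (w : Fin n → Fin n → ℝ)
    (hsymm : ∀ u v, w u v = w v u)
    (hnonneg : ∀ u v, 0 ≤ w u v)
    (hloop : ∀ u, w u u = 0)
    (Δ : ℝ) (hΔ : 0 < Δ)
    (hdegG : ∀ u, ∑ v, w u v ≤ Δ)
    (LG : Matrix (Fin n) (Fin n) ℝ) (hLGsymm : LG.IsSymm)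
    (hLG : ∀ x : Fin n → ℝ,
      x ⬝ᵥ (LG *ᵥ x) = (1 / 2) * ∑ u, ∑ v, w u v * (x u - x v) ^ 2)
    (EW : Finset (Fin n × Fin n)) (hEW : ∀ e ∈ EW, e.1 ≠ e.2)
    (hdegW : ∀ u : Fin n,
      ((EW.filter (fun e => e.1 = u ∨ e.2 = u)).card : ℝ) ≤ Δ)
    (δ k lam : ℝ) (hδ : 0 ≤ δ)
    (wb : Fin n × Fin n → ℝ)
    (h1 : (LG + ∑ e ∈ EW, wb e • edgeLap e - lam • Δ • Pbot n
        + δ • Δ • Pbot n).PosSemidef)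
    (h2 : -(δ * (EW.card : ℝ)) ≤ k - ∑ e ∈ EW, wb e)
    (h3 : ∀ e ∈ EW, -δ ≤ 1 - wb e) :
    (LG + ∑ e ∈ EW, (wb e - δ) • edgeLap e
        - (lam - 3 * δ) • Δ • Pbot n).PosSemidef ∧
    0 ≤ k - ∑ e ∈ EW, (wb e - δ) ∧
    ∀ e ∈ EW, 0 ≤ 1 - (wb e - δ) := by
  refine ⟨?_, ?_, fun e he => by linarith [h3 e he]⟩
  · convert h1.add ((aux_psd hn EW hEW Δ hdegW).smul hδ) using 1
    simp only [sub_smul, Finset.sum_sub_distrib, ← Finset.smul_sum]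
    module
  · rw [Finset.sum_sub_distrib, Finset.sum_const, nsmul_eq_mul]
    linarith
end

section
/- Let A and A' be real symmetric n×n matrices and let u ≤ u' be reals such that A ≺ uI and 0 ⪯ A' − A ⪯ (1/2)·(uI − A). Then uI − A ⪯ 2·(u'I − A'); in particular u'I − A' is positive definite. Consequently, for any ε > 0, q > 0, any nonzero v ∈ ℝ^n, and any R ≥ v^T (uI − A)^{-1} v, the vector w = √(ε/(q·R))·v satisfies w^T (u'I − A')^{-1} w ≤ 2ε/q. -/
open Matrix

theorem inv_aux {n : ℕ} (P B : Matrix (Fin n) (Fin n) ℝ) (hP : P.PosDef) (hB : B.PosDef)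
    (h : ((2 : ℝ) • B - P).PosSemidef) (v : Fin n → ℝ) :
    v ⬝ᵥ (B⁻¹ *ᵥ v) ≤ 2 * (v ⬝ᵥ (P⁻¹ *ᵥ v)) := by
  have hPx : P *ᵥ (P⁻¹ *ᵥ v) = v := by
    rw [mulVec_mulVec, mul_nonsing_inv _ ((isUnit_iff_isUnit_det _).1 hP.isUnit), one_mulVec]
  have hBy : B *ᵥ (B⁻¹ *ᵥ v) = v := by
    rw [mulVec_mulVec, mul_nonsing_inv _ ((isUnit_iff_isUnit_det _).1 hB.isUnit), one_mulVec]
  generalize P⁻¹ *ᵥ v = x at *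
  generalize B⁻¹ *ᵥ v = y at *
  have hPT : Pᵀ = P := by simpa using hP.isHermitian.eq
  have e1 := hP.posSemidef.dotProduct_mulVec_nonneg (x - (1 / 2 : ℝ) • y)
  have e2 := h.dotProduct_mulVec_nonneg y
  have e3 : x ⬝ᵥ (P *ᵥ y) = v ⬝ᵥ y := by
    rw [dotProduct_mulVec, ← mulVec_transpose, hPT, hPx]
  simp only [star_trivial, mulVec_sub, mulVec_smul, sub_mulVec, smul_mulVec, dotProduct_sub,
    sub_dotProduct, smul_dotProduct, dotProduct_smul, smul_eq_mul, hPx, hBy, e3,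
    dotProduct_comm x v, dotProduct_comm y v] at e1 e2
  linarith

/-- Let `A`, `A'` be real symmetric `n × n` matrices and `u ≤ u'` reals with
`A ≺ uI`, `0 ⪯ A' − A ⪯ (1/2)(uI − A)`. Then `uI − A ⪯ 2(u'I − A')`; in particular
`u'I − A'` is positive definite. Consequently, for any `ε > 0`, `q > 0`, any nonzero `v`,
and any `R ≥ vᵀ (uI − A)⁻¹ v`, the vector `w = √(ε/(qR)) v` satisfies
`wᵀ (u'I − A')⁻¹ w ≤ 2ε/q`. -/
theorem stmt_7 {n : ℕ}
    (A A' : Matrix (Fin n) (Fin n) ℝ) (hA : A.IsSymm) (hA' : A'.IsSymm)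
    (u u' : ℝ) (huu' : u ≤ u')
    (hAu : (u • (1 : Matrix (Fin n) (Fin n) ℝ) - A).PosDef)
    (h1 : (A' - A).PosSemidef)
    (h2 : ((1 / 2 : ℝ) • (u • (1 : Matrix (Fin n) (Fin n) ℝ) - A)
        - (A' - A)).PosSemidef) :
    ((2 : ℝ) • (u' • (1 : Matrix (Fin n) (Fin n) ℝ) - A')
        - (u • (1 : Matrix (Fin n) (Fin n) ℝ) - A)).PosSemidef ∧
    (u' • (1 : Matrix (Fin n) (Fin n) ℝ) - A').PosDef ∧
    ∀ ε q : ℝ, 0 < ε → 0 < q → ∀ v : Fin n → ℝ, v ≠ 0 → ∀ R : ℝ,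
      v ⬝ᵥ ((u • (1 : Matrix (Fin n) (Fin n) ℝ) - A)⁻¹ *ᵥ v) ≤ R →
      (Real.sqrt (ε / (q * R)) • v) ⬝ᵥ
          ((u' • (1 : Matrix (Fin n) (Fin n) ℝ) - A')⁻¹ *ᵥ
            (Real.sqrt (ε / (q * R)) • v)) ≤ 2 * ε / q := by
  have k1 : ((2 : ℝ) • (u' • (1 : Matrix (Fin n) (Fin n) ℝ) - A')
        - (u • (1 : Matrix (Fin n) (Fin n) ℝ) - A)).PosSemidef := by
    have a := (PosSemidef.one (n := Fin n) (R := ℝ)).smul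
      (show (0 : ℝ) ≤ 2 * (u' - u) by linarith)
    have b := h2.smul (show (0 : ℝ) ≤ 2 by norm_num)
    convert a.add b using 1
    module
  have k2 : (u' • (1 : Matrix (Fin n) (Fin n) ℝ) - A').PosDef := by
    have c := (hAu.add_posSemidef k1).smul (show (0 : ℝ) < 1 / 2 by norm_num)
    convert c using 1
    module
  refine ⟨k1, k2, ?_⟩
  intro ε q hε hq v hv R hR
  have k3 := inv_aux _ _ hAu k2 k1 v
  have k4 := hAu.inv.dotProduct_mulVec_pos hv
  rw [star_trivial] at k4
  have hRpos : 0 < R := lt_of_lt_of_le k4 hR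
  have hs : 0 ≤ ε / (q * R) := by positivity
  rw [mulVec_smul, smul_dotProduct, dotProduct_smul, smul_eq_mul, smul_eq_mul, ← mul_assoc,
    Real.mul_self_sqrt hs]
  calc _ ≤ ε / (q * R) * (2 * R) := mul_le_mul_of_nonneg_left (by linarith) hs
    _ = 2 * ε / q := by field_simp
end

section
/- Let q ≥ 10 be an integer and 0 < ε ≤ 1/20. Let u ∈ ℝ, T ∈ {1,…,n}, let A be a real symmetric n×n matrix with A ≺ uI, and let w ∈ ℝ^n satisfy w^T (uI − A)^{-1} w ≤ 2ε/q. For a real symmetric matrix M with M ≺ uI define the upper potential Φ^u_T(M) := Σ_{i=n−T+1}^{n} (u − λ_i(M))^{-q} (the sum over the T largest eigenvalues). Then A + ww^T ≺ uI and Φ^u_T(A + ww^T) ≤ Φ^u_T(A) + q·(1 + 2ε)·w^T (uI − A)^{-(q+1)} w. -/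
open Matrix

/- `sortedEig M i` is the `(i+1)`-st smallest eigenvalue `λ_{i+1}(M)` of a real symmetric
matrix `M`, i.e. the eigenvalues listed in nondecreasing order; junk value `0` if `M` is not
symmetric. -/
open Classical in
noncomputable def sortedEig {n : ℕ} (M : Matrix (Fin n) (Fin n) ℝ) : Fin n → ℝ :=
  if h : M.IsHermitian then h.eigenvalues ∘ Tuple.sort h.eigenvalues else 0

/-- The upper potential `Φ^u_T(M) = Σ_{i = n−T+1}^{n} (u − λ_i(M))^{-q}`, the sum being over
the `T` largest eigenvalues of `M`. -/
noncomputable def upperPot {n : ℕ} (u : ℝ) (T q : ℕ)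
    (M : Matrix (Fin n) (Fin n) ℝ) : ℝ :=
  ∑ i ∈ Finset.univ.filter (fun i : Fin n => n - T ≤ (i : ℕ)),
    1 / (u - sortedEig M i) ^ q


lemma sorted_spec {n : ℕ} (M : Matrix (Fin n) (Fin n) ℝ) (hM : M.IsHermitian) :
    ∃ U : Matrix (Fin n) (Fin n) ℝ, U * Uᵀ = 1 ∧ Uᵀ * U = 1 ∧
      M = U * diagonal (sortedEig M) * Uᵀ ∧ Monotone (sortedEig M) := by
  have hs : sortedEig M = hM.eigenvalues ∘ Tuple.sort hM.eigenvalues := by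
    rw [sortedEig, dif_pos hM]
  set σ := Tuple.sort hM.eigenvalues with hσ
  set V : Matrix (Fin n) (Fin n) ℝ := (hM.eigenvectorUnitary : Matrix (Fin n) (Fin n) ℝ) with hV
  have h1 : V * Vᵀ = 1 := by
    have := Unitary.coe_mul_star_self hM.eigenvectorUnitary
    simpa [star_eq_conjTranspose] using! this
  have h2 : Vᵀ * V = 1 := by
    have := Unitary.coe_star_mul_self hM.eigenvectorUnitary
    simpa [star_eq_conjTranspose] using! this
  have h3 : M = V * diagonal hM.eigenvalues * Vᵀ := by
    have := hM.spectral_theorem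
    rw [Unitary.conjStarAlgAut_apply] at this
    simpa [star_eq_conjTranspose] using! this
  refine ⟨V.submatrix id σ, ?_, ?_, ?_, ?_⟩
  · rw [transpose_submatrix, submatrix_mul_equiv, h1]; simp
  · rw [transpose_submatrix, ← submatrix_mul _ _ _ id _ Function.bijective_id, h2]
    simp
  · rw [hs]
    have : diagonal (hM.eigenvalues ∘ σ) = (diagonal hM.eigenvalues).submatrix σ σ := by
      simp
    rw [this, transpose_submatrix, submatrix_mul_equiv, submatrix_mul_equiv, ← h3]; simp
  · rw [hs]; exact Tuple.monotone_sort _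

lemma quad_spec {n : ℕ} (U : Matrix (Fin n) (Fin n) ℝ) (d : Fin n → ℝ) (v : Fin n → ℝ) :
    v ⬝ᵥ ((U * diagonal d * Uᵀ) *ᵥ v) = ∑ k, d k * ((Uᵀ *ᵥ v) k) ^ 2 := by
  rw [← mulVec_mulVec, ← mulVec_mulVec, dotProduct_mulVec, ← mulVec_transpose]
  simp only [dotProduct, mulVec_diagonal]
  exact Finset.sum_congr rfl fun k _ => by ring

lemma weyl_mono {n : ℕ} (M N : Matrix (Fin n) (Fin n) ℝ) (hM : M.IsHermitian)
    (hN : N.IsHermitian) (hMN : ∀ v, v ⬝ᵥ (M *ᵥ v) ≤ v ⬝ᵥ (N *ᵥ v)) (i : Fin n) :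
    sortedEig M i ≤ sortedEig N i := by
  obtain ⟨U, hU1, hU2, hMe, hm⟩ := sorted_spec M hM
  obtain ⟨W, hW1, hW2, hNe, hn⟩ := sorted_spec N hN
  set d := sortedEig M
  set e := sortedEig N
  let R : Matrix (Fin n) (Fin n) ℝ := fun k =>
    if k < i then Uᵀ k else if k = i then 0 else Wᵀ k
  have hdet : R.det = 0 := det_eq_zero_of_row_eq_zero i (by intro j; simp [R])
  obtain ⟨v, hv0, hv⟩ := exists_mulVec_eq_zero_iff.mpr hdet
  have hUv : ∀ k, k < i → (Uᵀ *ᵥ v) k = 0 := by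
    intro k hk
    have := congrFun hv k
    simpa [R, mulVec, hk] using this
  have hWv : ∀ k, i < k → (Wᵀ *ᵥ v) k = 0 := by
    intro k hk
    have := congrFun hv k
    simpa [R, mulVec, hk.not_gt, hk.ne'] using this
  have nU : ∑ k, ((Uᵀ *ᵥ v) k) ^ 2 = v ⬝ᵥ v := by
    have := quad_spec U 1 v
    simpa [hU1] using this.symm
  have nW : ∑ k, ((Wᵀ *ᵥ v) k) ^ 2 = v ⬝ᵥ v := by
    have := quad_spec W 1 v
    simpa [hW1] using this.symm
  have hpos : 0 < v ⬝ᵥ v := by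
    have := dotProduct_star_self_pos_iff.mpr hv0
    simpa using this
  have h := hMN v
  rw [hMe, hNe, quad_spec, quad_spec] at h
  have l1 : d i * (v ⬝ᵥ v) ≤ ∑ k, d k * ((Uᵀ *ᵥ v) k) ^ 2 := by
    rw [← nU, Finset.mul_sum]
    refine Finset.sum_le_sum fun k _ => ?_
    rcases lt_or_ge k i with hk | hk
    · simp [hUv k hk]
    · exact mul_le_mul_of_nonneg_right (hm hk) (sq_nonneg _)
  have l2 : ∑ k, e k * ((Wᵀ *ᵥ v) k) ^ 2 ≤ e i * (v ⬝ᵥ v) := by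
    rw [← nW, Finset.mul_sum]
    refine Finset.sum_le_sum fun k _ => ?_
    rcases lt_or_ge i k with hk | hk
    · simp [hWv k hk]
    · exact mul_le_mul_of_nonneg_right (hn hk) (sq_nonneg _)
  exact le_of_mul_le_mul_right (by linarith) hpos

lemma inv_spec {n : ℕ} (u : ℝ) (M : Matrix (Fin n) (Fin n) ℝ) (hM : M.IsHermitian)
    (hp : (u • (1 : Matrix (Fin n) (Fin n) ℝ) - M).PosDef) :
    (∀ i, 0 < u - sortedEig M i) ∧ ∃ U : Matrix (Fin n) (Fin n) ℝ, Uᵀ * U = 1 ∧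
      ∀ k : ℕ, ((u • (1 : Matrix (Fin n) (Fin n) ℝ) - M)⁻¹) ^ k =
        U * diagonal (fun i => (1 / (u - sortedEig M i)) ^ k) * Uᵀ := by
  obtain ⟨U, hU1, hU2, hMe, -⟩ := sorted_spec M hM
  set d := sortedEig M
  have hB : u • (1 : Matrix (Fin n) (Fin n) ℝ) - M = U * diagonal (fun i => u - d i) * Uᵀ := by
    have : diagonal (fun i => u - d i) = u • (1 : Matrix (Fin n) (Fin n) ℝ) - diagonal d := by
      rw [smul_one_eq_diagonal, diagonal_sub]
    rw [this, Matrix.mul_sub, Matrix.sub_mul, ← hMe]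
    simp [hU1]
  have hpos : ∀ i, 0 < u - d i := by
    intro i
    have hne : U *ᵥ Pi.single i 1 ≠ 0 := by
      intro h
      have := congrArg (fun x => (Uᵀ *ᵥ x) i) h
      simp only [mulVec_mulVec, hU2] at this
      simp at this
    have := hp.dotProduct_mulVec_pos hne
    rw [star_trivial, hB, quad_spec] at this
    simpa [mulVec_mulVec, hU2, -mulVec_single, Pi.single_apply] using this
  refine ⟨hpos, U, hU2, ?_⟩
  have hX : (u • (1 : Matrix (Fin n) (Fin n) ℝ) - M)⁻¹ =
      U * diagonal (fun i => 1 / (u - d i)) * Uᵀ := by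
    apply inv_eq_right_inv
    rw [hB]
    calc _ = U * diagonal (fun i => u - d i) * (Uᵀ * U) * diagonal (fun i => 1 / (u - d i)) * Uᵀ := by
          simp only [Matrix.mul_assoc]
      _ = U * (diagonal (fun i => u - d i) * diagonal (fun i => 1 / (u - d i))) * Uᵀ := by
          rw [hU2]; simp only [Matrix.mul_assoc, Matrix.one_mul]
      _ = 1 := by
          rw [diagonal_mul_diagonal]
          have : (fun i => (u - d i) * (1 / (u - d i))) = fun _ => 1 := by
            funext i; have := (hpos i).ne'; field_simp
          rw [this]; simp [hU1]
  intro k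
  induction k with
  | zero => simp [hU1]
  | succ k ih =>
    rw [pow_succ, ih, hX]
    calc _ = U * diagonal (fun i => (1 / (u - d i)) ^ k) * (Uᵀ * U) * diagonal (fun i => 1 / (u - d i)) * Uᵀ := by
          simp only [Matrix.mul_assoc]
      _ = U * (diagonal (fun i => (1 / (u - d i)) ^ k) * diagonal (fun i => 1 / (u - d i))) * Uᵀ := by
          rw [hU2]; simp only [Matrix.mul_assoc, Matrix.one_mul]
      _ = _ := by
          rw [diagonal_mul_diagonal]
          simp only [pow_succ]

lemma trace_spec {n : ℕ} (u : ℝ) (M : Matrix (Fin n) (Fin n) ℝ) (hM : M.IsHermitian)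
    (hp : (u • (1 : Matrix (Fin n) (Fin n) ℝ) - M).PosDef) (q : ℕ) :
    (((u • (1 : Matrix (Fin n) (Fin n) ℝ) - M)⁻¹) ^ q).trace =
      ∑ i, 1 / (u - sortedEig M i) ^ q := by
  obtain ⟨-, U, hU, h⟩ := inv_spec u M hM hp
  rw [h q, trace_mul_comm, ← Matrix.mul_assoc, hU, Matrix.one_mul, trace_diagonal]
  simp

lemma cheb {n : ℕ} (c x : Fin n → ℝ) (hc : ∀ i, 0 ≤ c i) (hx : ∀ i, 0 ≤ x i) (a b : ℕ) :
    (∑ i, x i ^ (a + 1) * c i) * (∑ i, x i ^ (b + 1) * c i) ≤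
      (∑ i, x i ^ 1 * c i) * (∑ i, x i ^ (a + b + 1) * c i) := by
  have h : 0 ≤ ∑ i, ∑ j, (c i * x i) * (c j * x j) * ((x i ^ a - x j ^ a) * (x i ^ b - x j ^ b)) := by
    refine Finset.sum_nonneg fun i _ => Finset.sum_nonneg fun j _ => ?_
    refine mul_nonneg (mul_nonneg (mul_nonneg (hc i) (hx i)) (mul_nonneg (hc j) (hx j))) ?_
    rcases le_total (x i) (x j) with h | h
    · exact mul_nonneg_of_nonpos_of_nonpos
        (sub_nonpos.mpr (pow_le_pow_left₀ (hx i) h a)) (sub_nonpos.mpr (pow_le_pow_left₀ (hx i) h b))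
    · exact mul_nonneg
        (sub_nonneg.mpr (pow_le_pow_left₀ (hx j) h a)) (sub_nonneg.mpr (pow_le_pow_left₀ (hx j) h b))
  have e : ∑ i, ∑ j, (c i * x i) * (c j * x j) * ((x i ^ a - x j ^ a) * (x i ^ b - x j ^ b)) =
      (∑ i, x i ^ (a + b + 1) * c i) * (∑ i, x i ^ 1 * c i)
      + (∑ i, x i ^ 1 * c i) * (∑ i, x i ^ (a + b + 1) * c i)
      - (∑ i, x i ^ (a + 1) * c i) * (∑ i, x i ^ (b + 1) * c i)
      - (∑ i, x i ^ (b + 1) * c i) * (∑ i, x i ^ (a + 1) * c i) := by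
    simp only [Finset.sum_mul_sum, ← Finset.sum_add_distrib, ← Finset.sum_sub_distrib]
    exact Finset.sum_congr rfl fun i _ => Finset.sum_congr rfl fun j _ => by ring
  nlinarith

lemma moment {n : ℕ} (u : ℝ) (M : Matrix (Fin n) (Fin n) ℝ) (hM : M.IsHermitian)
    (hp : (u • (1 : Matrix (Fin n) (Fin n) ℝ) - M).PosDef) (w : Fin n → ℝ) :
    ∃ m : ℕ → ℝ, (∀ k, w ⬝ᵥ (((u • (1 : Matrix (Fin n) (Fin n) ℝ) - M)⁻¹) ^ k *ᵥ w) = m k) ∧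
      (∀ k, 0 ≤ m k) ∧ ∀ a b, m (a + 1) * m (b + 1) ≤ m 1 * m (a + b + 1) := by
  obtain ⟨hpos, U, hU, h⟩ := inv_spec u M hM hp
  refine ⟨fun k => ∑ i, (1 / (u - sortedEig M i)) ^ k * ((Uᵀ *ᵥ w) i) ^ 2, ?_, ?_, ?_⟩
  · intro k; rw [h k, quad_spec]
  · intro k
    exact Finset.sum_nonneg fun i _ => mul_nonneg (pow_nonneg (one_div_pos.mpr (hpos i)).le _) (sq_nonneg _)
  · intro a b
    exact cheb _ _ (fun i => sq_nonneg _) (fun i => (one_div_pos.mpr (hpos i)).le) a b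

lemma posdef_sub {n : ℕ} (B : Matrix (Fin n) (Fin n) ℝ) (hB : B.PosDef) (w : Fin n → ℝ)
    (hs : w ⬝ᵥ (B⁻¹ *ᵥ w) < 1) : (B - vecMulVec w w).PosDef := by
  have hBi : B * B⁻¹ = 1 := mul_nonsing_inv _ ((isUnit_iff_isUnit_det B).mp hB.isUnit)
  have hBT : Bᵀ = B := by simpa using hB.isHermitian.eq
  refine .of_dotProduct_mulVec_pos (hB.isHermitian.sub ?_) fun v hv => ?_
  · ext i j; simp [vecMulVec_apply, mul_comm]
  · rw [star_trivial]
    have h1 := hB.dotProduct_mulVec_pos hv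
    rw [star_trivial] at h1
    have e : v ⬝ᵥ ((B - vecMulVec w w) *ᵥ v) = v ⬝ᵥ (B *ᵥ v) - (w ⬝ᵥ v) ^ 2 := by
      rw [sub_mulVec, dotProduct_sub, vecMulVec_mulVec]
      simp [dotProduct_comm v w]; ring
    rw [e]
    set t := w ⬝ᵥ v
    set y := B⁻¹ *ᵥ w with hy
    have hBy : B *ᵥ y = w := by rw [hy, mulVec_mulVec, hBi, one_mulVec]
    have h2 := hB.posSemidef.dotProduct_mulVec_nonneg (v - t • y)
    rw [star_trivial] at h2
    have e2 : y ⬝ᵥ (B *ᵥ v) = t := by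
      rw [dotProduct_mulVec, ← mulVec_transpose, hBT, hBy]
    have e3 : v ⬝ᵥ w = t := dotProduct_comm _ _
    have e4 : y ⬝ᵥ w = w ⬝ᵥ y := dotProduct_comm _ _
    simp only [mulVec_sub, mulVec_smul, hBy, sub_dotProduct, dotProduct_sub, smul_dotProduct,
      dotProduct_smul, e2, e3, e4, smul_eq_mul] at h2
    rcases eq_or_ne t 0 with h0 | h0
    · rw [h0]; linarith
    · have : 0 < t ^ 2 := by positivity
      nlinarith

lemma sherman {n : ℕ} (B : Matrix (Fin n) (Fin n) ℝ) (hB : B.PosDef) (w : Fin n → ℝ)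
    (hs : w ⬝ᵥ (B⁻¹ *ᵥ w) < 1) : (B - vecMulVec w w)⁻¹ =
      B⁻¹ + (1 - w ⬝ᵥ (B⁻¹ *ᵥ w))⁻¹ • vecMulVec (B⁻¹ *ᵥ w) (B⁻¹ *ᵥ w) := by
  have hBi : B * B⁻¹ = 1 := mul_nonsing_inv _ ((isUnit_iff_isUnit_det B).mp hB.isUnit)
  have hXT : (B⁻¹)ᵀ = B⁻¹ := by
    rw [transpose_nonsing_inv]; congr 1; simpa using hB.isHermitian.eq
  apply inv_eq_right_inv
  set s := w ⬝ᵥ (B⁻¹ *ᵥ w)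
  have hs' : (1 - s) ≠ 0 := by linarith
  have e1 : vecMulVec w w * B⁻¹ = vecMulVec w (B⁻¹ *ᵥ w) := by
    rw [vecMulVec_mul, ← mulVec_transpose, hXT]
  have e2 : B * vecMulVec (B⁻¹ *ᵥ w) (B⁻¹ *ᵥ w) = vecMulVec w (B⁻¹ *ᵥ w) := by
    rw [mul_vecMulVec, mulVec_mulVec, hBi, one_mulVec]
  have e3 : vecMulVec w w * vecMulVec (B⁻¹ *ᵥ w) (B⁻¹ *ᵥ w) = s • vecMulVec w (B⁻¹ *ᵥ w) := by
    rw [vecMulVec_mul_vecMulVec]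
    ext i j; simp [vecMulVec_apply, s]; ring
  rw [Matrix.sub_mul, Matrix.mul_add, Matrix.mul_add, Matrix.mul_smul, Matrix.mul_smul, hBi, e1, e2, e3]
  ext i j
  simp only [Matrix.sub_apply, Matrix.add_apply, Matrix.smul_apply, smul_eq_mul]
  field_simp
  ring

lemma trace_bound {n : ℕ} (X Y : Matrix (Fin n) (Fin n) ℝ) (w : Fin n → ℝ) (c : ℝ) (m : ℕ → ℝ)
    (hXT : Xᵀ = X) (hY : Y = X + c • vecMulVec (X *ᵥ w) (X *ᵥ w))
    (hm : ∀ k, w ⬝ᵥ (X ^ k *ᵥ w) = m k) (hm0 : ∀ k, 0 ≤ m k)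
    (hch : ∀ a b, m (a + 1) * m (b + 1) ≤ m 1 * m (a + b + 1))
    (hc0 : 0 ≤ c) (hc : 1 + c * m 1 = c) (q : ℕ) :
    (Y ^ q).trace - (X ^ q).trace ≤ (∑ i ∈ Finset.range q, c ^ (i + 1)) * m (q + 1) := by
  have hXk : ∀ a v, w ⬝ᵥ (X ^ (a + 1) *ᵥ v) = (X *ᵥ w) ⬝ᵥ (X ^ a *ᵥ v) := by
    intro a v
    rw [pow_succ', ← mulVec_mulVec, dotProduct_mulVec, ← mulVec_transpose, hXT]
  have hp : ∀ i a, 1 ≤ a → w ⬝ᵥ (X ^ a *ᵥ (Y ^ i *ᵥ (X *ᵥ w))) ≤ c ^ i * m (a + i + 1) := by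
    intro i
    induction i with
    | zero =>
      intro a _
      rw [pow_zero, one_mulVec, mulVec_mulVec, ← pow_succ, hm]; simp
    | succ i ih =>
      intro a ha
      have e : w ⬝ᵥ (X ^ a *ᵥ (Y ^ (i + 1) *ᵥ (X *ᵥ w))) =
          w ⬝ᵥ (X ^ (a + 1) *ᵥ (Y ^ i *ᵥ (X *ᵥ w))) +
            c * m (a + 1) * (w ⬝ᵥ (X ^ 1 *ᵥ (Y ^ i *ᵥ (X *ᵥ w)))) := by
        rw [pow_succ' Y, ← mulVec_mulVec]
        set z := Y ^ i *ᵥ (X *ᵥ w)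
        rw [hXk 0 z, pow_zero, one_mulVec, hY, add_mulVec, smul_mulVec, vecMulVec_mulVec,
          mulVec_add, dotProduct_add, mulVec_mulVec, ← pow_succ, mulVec_smul, dotProduct_smul,
          ← hm (a + 1), pow_succ X a, ← mulVec_mulVec]
        simp [mulVec_smul]
        ring
      rw [e]
      have h1 := ih (a + 1) (by omega)
      have h2 := ih 1 le_rfl
      have h3 := hch a (i + 1)
      have e1 : a + 1 + i + 1 = a + (i + 1) + 1 := by ring
      have e2 : 1 + i + 1 = i + 1 + 1 := by ring
      rw [e1] at h1
      rw [e2] at h2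
      have h4 := mul_le_mul_of_nonneg_left h2 (mul_nonneg hc0 (hm0 (a + 1)))
      have h5 := mul_le_mul_of_nonneg_left h3 (pow_nonneg hc0 (i + 1))
      calc _ ≤ c ^ i * m (a + (i + 1) + 1) + c ^ (i + 1) * (m 1 * m (a + (i + 1) + 1)) := by
            refine add_le_add h1 (h4.trans (le_trans (le_of_eq ?_) h5)); ring
        _ = c ^ i * (1 + c * m 1) * m (a + (i + 1) + 1) := by ring
        _ = _ := by rw [hc]; ring
  -- telescoping
  have tel : ∀ k j, 1 ≤ j → k + j = q → (Y ^ k * X ^ j).trace - (X ^ q).trace ≤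
      (∑ i ∈ Finset.range k, c ^ (i + 1)) * m (q + 1) := by
    intro k
    induction k with
    | zero => intro j _ hj; simp at hj; simp [hj]
    | succ k ih => 
      intro j hj hkj
      have h1 := ih (j + 1) (by omega) (by omega)
      have e : (Y ^ (k + 1) * X ^ j).trace = (Y ^ k * X ^ (j + 1)).trace +
          c * (w ⬝ᵥ (X ^ (j + 1) *ᵥ (Y ^ k *ᵥ (X *ᵥ w)))) := by
        have : Y ^ (k + 1) * X ^ j = Y ^ k * X ^ (j + 1) +
            c • (Y ^ k * (vecMulVec (X *ᵥ w) (X *ᵥ w) * X ^ j)) := by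
          rw [pow_succ Y, pow_succ' X]
          conv_lhs => rw [Matrix.mul_assoc]; enter [2]; rw [hY]
          rw [Matrix.add_mul, Matrix.mul_add, Matrix.smul_mul, Matrix.mul_smul]
        rw [this, trace_add, trace_smul, vecMulVec_mul, mul_vecMulVec, trace_vecMulVec, hXk,
          dotProduct_comm, ← dotProduct_mulVec, smul_eq_mul]
      have h2 := mul_le_mul_of_nonneg_left (hp k (j + 1) (by omega)) hc0
      rw [e, Finset.sum_range_succ, add_mul]
      have e3 : j + 1 + k + 1 = q + 1 := by omega
      rw [e3] at h2
      have : c ^ (k + 1) * m (q + 1) = c * (c ^ k * m (q + 1)) := by ring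
      linarith
  rcases q with _ | q
  · simp
  · have h1 := tel q 1 le_rfl rfl
    have e : (Y ^ (q + 1)).trace = (Y ^ q * X ^ 1).trace +
          c * (w ⬝ᵥ (X ^ 1 *ᵥ (Y ^ q *ᵥ (X *ᵥ w)))) := by
      rw [pow_succ Y]
      conv_lhs => enter [1, 2]; rw [hY]
      rw [Matrix.mul_add, Matrix.mul_smul, trace_add, trace_smul, mul_vecMulVec, trace_vecMulVec,
        hXk 0, pow_one, pow_zero, one_mulVec, dotProduct_comm, smul_eq_mul]
    have h2 := mul_le_mul_of_nonneg_left (hp q 1 le_rfl) hc0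
    have e3 : 1 + q + 1 = q + 1 + 1 := by omega
    rw [e3] at h2
    rw [e, Finset.sum_range_succ, add_mul]
    have : c ^ (q + 1) * m (q + 1 + 1) = c * (c ^ q * m (q + 1 + 1)) := by ring
    linarith

lemma scalar_bound (q : ℕ) (hq : 10 ≤ q) (ε : ℝ) (hε0 : 0 < ε) (hε : ε ≤ 1 / 20) (s : ℝ)
    (hs0 : 0 ≤ s) (hs : s ≤ 2 * ε / q) :
    ∑ i ∈ Finset.range q, ((1 - s)⁻¹) ^ (i + 1) ≤ q * (1 + 2 * ε) := by
  have hq' : (10 : ℝ) ≤ q := by exact_mod_cast hq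
  have hsq : s * q ≤ 2 * ε := by rwa [le_div_iff₀ (by linarith)] at hs
  have hs1 : s < 1 := by nlinarith
  have key : ∀ i ∈ Finset.range q, ((1 - s)⁻¹) ^ (i + 1) ≤ 1 + 10 / 9 * s * ((i : ℝ) + 1) := by
    intro i hi
    have hi' : (i : ℝ) + 1 ≤ q := by exact_mod_cast Finset.mem_range.mp hi
    have hb := one_add_mul_le_pow (a := -s) (by linarith) (i + 1)
    push_cast at hb
    have hx : s * ((i : ℝ) + 1) ≤ 1 / 10 := by nlinarith
    have hx0 : 0 ≤ s * ((i : ℝ) + 1) := by positivity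
    rw [inv_pow]
    have h1 : 0 < 1 - s * ((i : ℝ) + 1) := by linarith
    have h2 : 1 - s * ((i : ℝ) + 1) ≤ (1 - s) ^ (i + 1) := by
      rw [sub_eq_add_neg 1 s]; linarith
    refine (inv_anti₀ h1 h2).trans ?_
    rw [inv_le_iff_one_le_mul₀ h1]
    nlinarith
  refine (Finset.sum_le_sum key).trans ?_
  have hsum : ∀ q : ℕ, ∑ i ∈ Finset.range q, (1 + 10 / 9 * s * ((i : ℝ) + 1)) =
      q + 10 / 9 * s * (q * (q + 1) / 2) := by
    intro q
    induction q with
    | zero => simp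
    | succ k ih => rw [Finset.sum_range_succ, ih]; push_cast; ring
  rw [hsum]
  have h1 : s * q * (q + 1) ≤ 2 * ε * (q + 1) := mul_le_mul_of_nonneg_right hsq (by linarith)
  nlinarith

theorem stmt_8 {n : ℕ} (q : ℕ) (hq : 10 ≤ q)
    (ε : ℝ) (hε0 : 0 < ε) (hε : ε ≤ 1 / 20)
    (u : ℝ) (T : ℕ) (hT1 : 1 ≤ T) (hTn : T ≤ n)
    (A : Matrix (Fin n) (Fin n) ℝ) (hA : A.IsHermitian)
    (hAu : (u • (1 : Matrix (Fin n) (Fin n) ℝ) - A).PosDef)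
    (w : Fin n → ℝ)
    (hw : w ⬝ᵥ ((u • (1 : Matrix (Fin n) (Fin n) ℝ) - A)⁻¹ *ᵥ w) ≤ 2 * ε / q) :
    (u • (1 : Matrix (Fin n) (Fin n) ℝ) - (A + Matrix.vecMulVec w w)).PosDef ∧
    upperPot u T q (A + Matrix.vecMulVec w w) ≤
      upperPot u T q A + q * (1 + 2 * ε) *
        (w ⬝ᵥ ((((u • (1 : Matrix (Fin n) (Fin n) ℝ) - A)⁻¹) ^ (q + 1)) *ᵥ w)) := by
  have hq' : (10 : ℝ) ≤ q := by exact_mod_cast hq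
  have hs1 : w ⬝ᵥ ((u • (1 : Matrix (Fin n) (Fin n) ℝ) - A)⁻¹ *ᵥ w) < 1 := by
    refine hw.trans_lt ?_
    rw [div_lt_iff₀ (by linarith)]; linarith
  have hsub : u • (1 : Matrix (Fin n) (Fin n) ℝ) - (A + Matrix.vecMulVec w w) =
      (u • (1 : Matrix (Fin n) (Fin n) ℝ) - A) - vecMulVec w w := by abel
  have hp' : (u • (1 : Matrix (Fin n) (Fin n) ℝ) - (A + Matrix.vecMulVec w w)).PosDef := by
    rw [hsub]; exact posdef_sub _ hAu w hs1
  refine ⟨hp', ?_⟩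
  have hA' : (A + Matrix.vecMulVec w w).IsHermitian := by
    refine hA.add ?_
    ext i j; simp [vecMulVec_apply, mul_comm]
  obtain ⟨m, hm, hm0, hch⟩ := moment u A hA hAu w
  have hm1 := hm 1
  rw [pow_one] at hm1
  have hXT : ((u • (1 : Matrix (Fin n) (Fin n) ℝ) - A)⁻¹)ᵀ =
      (u • (1 : Matrix (Fin n) (Fin n) ℝ) - A)⁻¹ := by
    rw [transpose_nonsing_inv]; congr 1; simpa using hAu.isHermitian.eq
  have hsm := sherman _ hAu w hs1
  rw [← hsub, hm1] at hsm
  rw [hm1] at hw hs1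
  have h1s : 0 < 1 - m 1 := by linarith
  have htb := trace_bound _ _ w _ m hXT hsm hm hm0 hch (inv_pos.mpr h1s).le
    (by field_simp; ring) q
  rw [trace_spec u _ hA' hp', trace_spec u _ hA hAu] at htb
  have hsb := mul_le_mul_of_nonneg_right (scalar_bound q hq ε hε0 hε (m 1) (hm0 1) hw) (hm0 (q + 1))
  rw [hm (q + 1)]
  have hpos := (inv_spec u _ hA' hp').1
  have hmono : ∀ i, 1 / (u - sortedEig A i) ^ q ≤
      1 / (u - sortedEig (A + Matrix.vecMulVec w w) i) ^ q := by
    intro i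
    have hle := weyl_mono A (A + Matrix.vecMulVec w w) hA hA' (by
      intro v
      rw [add_mulVec, dotProduct_add, vecMulVec_mulVec]
      have : 0 ≤ (w ⬝ᵥ v) * (w ⬝ᵥ v) := mul_self_nonneg _
      simpa [dotProduct_comm v w] using this) i
    exact one_div_le_one_div_of_le (pow_pos (hpos i) q)
      (pow_le_pow_left₀ (hpos i).le (by linarith) q)
  have hT : upperPot u T q (A + Matrix.vecMulVec w w) - upperPot u T q A ≤
      ∑ i, 1 / (u - sortedEig (A + Matrix.vecMulVec w w) i) ^ q -
        ∑ i, 1 / (u - sortedEig A i) ^ q := by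
    unfold upperPot
    rw [← Finset.sum_sub_distrib, ← Finset.sum_sub_distrib]
    exact Finset.sum_le_sum_of_subset_of_nonneg (Finset.filter_subset _ _)
      fun i _ _ => sub_nonneg.mpr (hmono i)
  linarith
end

section
/- Let q ≥ 10 be an integer and 0 < ε ≤ 1/20. Let C be a real symmetric positive definite k×k matrix and let y ∈ ℝ^k satisfy y^T C^{-1} y ≤ 2ε/q. Then tr[(C + yy^T)^{-q}] ≤ tr[C^{-q}] − q·(1 − 2ε)·y^T C^{-(q+1)} y. -/
open Matrix

theorem quad_pow_aux {k : ℕ} (A : Matrix (Fin k) (Fin k) ℝ) (hA : A.PosDef) (y : Fin k → ℝ) :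
    ∃ l w : Fin k → ℝ, (∀ j, 0 < l j) ∧ ∀ i : ℕ, y ⬝ᵥ ((A ^ i) *ᵥ y) = ∑ j, l j ^ i * w j ^ 2 := by
  set U : Matrix (Fin k) (Fin k) ℝ := (hA.1.eigenvectorUnitary : Matrix (Fin k) (Fin k) ℝ) with hU
  have hUU : Uᵀ * U = 1 := by
    have := Unitary.coe_star_mul_self hA.1.eigenvectorUnitary
    simpa [Matrix.star_eq_conjTranspose] using this
  have hUU' : U * Uᵀ = 1 := mul_eq_one_comm.mp hUU
  have hs : A = U * diagonal hA.1.eigenvalues * Uᵀ := by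
    have := hA.1.spectral_theorem
    rw [Unitary.conjStarAlgAut_apply] at this
    simpa [Matrix.star_eq_conjTranspose, Function.comp_def] using this
  have hpos := hA.eigenvalues_pos
  clear_value U
  generalize hA.1.eigenvalues = d at hs hpos
  have hp : ∀ i : ℕ, A ^ i = U * diagonal (fun j => d j ^ i) * Uᵀ := by
    intro i
    induction i with
    | zero => simp [hUU']
    | succ n ih =>
      rw [pow_succ, ih]
      rw [hs]
      calc _ = U * diagonal (fun j => d j ^ n) * (Uᵀ * U) *
              diagonal d * Uᵀ := by simp only [Matrix.mul_assoc]
        _ = _ := by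
          rw [hUU, Matrix.mul_one, Matrix.mul_assoc U, diagonal_mul_diagonal]
          simp only [pow_succ]
  refine ⟨d, Uᵀ *ᵥ y, hpos, fun i => ?_⟩
  rw [hp i, ← Matrix.mulVec_mulVec, ← Matrix.mulVec_mulVec, Matrix.dotProduct_mulVec,
    ← Matrix.mulVec_transpose]
  simp only [dotProduct, Matrix.mulVec_diagonal]
  refine Finset.sum_congr rfl fun j _ => ?_
  ring

theorem cheb_aux {k : ℕ} (l w : Fin k → ℝ) (hl : ∀ j, 0 < l j) (i m : ℕ) :
    (∑ j, l j ^ (i+1) * w j ^ 2) * (∑ j, l j ^ (m+1) * w j ^ 2) ≤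
      (∑ j, l j ^ 1 * w j ^ 2) * (∑ j, l j ^ (i+m+1) * w j ^ 2) := by
  have key : 0 ≤ ∑ a, ∑ b, (l a * w a ^ 2) * (l b * w b ^ 2) *
      ((l a ^ i - l b ^ i) * (l a ^ m - l b ^ m)) := by
    refine Finset.sum_nonneg fun a _ => Finset.sum_nonneg fun b _ => ?_
    have h1 := hl a
    have h2 := hl b
    refine mul_nonneg (by positivity) ?_
    rcases le_total (l a) (l b) with h | h
    · exact mul_nonneg_of_nonpos_of_nonpos (sub_nonpos.2 (pow_le_pow_left₀ h1.le h _))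
        (sub_nonpos.2 (pow_le_pow_left₀ h1.le h _))
    · exact mul_nonneg (sub_nonneg.2 (pow_le_pow_left₀ h2.le h _))
        (sub_nonneg.2 (pow_le_pow_left₀ h2.le h _))
  have e : ∑ a, ∑ b, (l a * w a ^ 2) * (l b * w b ^ 2) *
      ((l a ^ i - l b ^ i) * (l a ^ m - l b ^ m)) =
      (∑ j, l j ^ (i+m+1) * w j ^ 2) * (∑ j, l j ^ 1 * w j ^ 2)
      + (∑ j, l j ^ 1 * w j ^ 2) * (∑ j, l j ^ (i+m+1) * w j ^ 2)
      - (∑ j, l j ^ (i+1) * w j ^ 2) * (∑ j, l j ^ (m+1) * w j ^ 2)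
      - (∑ j, l j ^ (m+1) * w j ^ 2) * (∑ j, l j ^ (i+1) * w j ^ 2) := by
    simp only [Finset.sum_mul_sum, ← Finset.sum_add_distrib, ← Finset.sum_sub_distrib]
    refine Finset.sum_congr rfl fun a _ => Finset.sum_congr rfl fun b _ => ?_
    ring
  rw [e] at key
  linarith

theorem quad_vec_aux {k : ℕ} (M N : Matrix (Fin k) (Fin k) ℝ) (y : Fin k → ℝ) :
    y ⬝ᵥ ((M * vecMulVec y y * N) *ᵥ y) = (y ⬝ᵥ (M *ᵥ y)) * (y ⬝ᵥ (N *ᵥ y)) := by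
  rw [← Matrix.mulVec_mulVec, ← Matrix.mulVec_mulVec, Matrix.vecMulVec_mulVec]
  simp [Matrix.mulVec_smul, mul_comm]

/-- Let `q ≥ 10`, `0 < ε ≤ 1/20`, `C` a real symmetric positive definite
`k × k` matrix and `y` with `yᵀ C⁻¹ y ≤ 2ε/q`. Then
`tr[(C + yyᵀ)^{-q}] ≤ tr[C^{-q}] − q(1 − 2ε) · yᵀ C^{−(q+1)} y`. -/
theorem stmt_9 {k : ℕ} (q : ℕ) (hq : 10 ≤ q)
    (ε : ℝ) (hε0 : 0 < ε) (hε : ε ≤ 1 / 20)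
    (C : Matrix (Fin k) (Fin k) ℝ) (hC : C.PosDef)
    (y : Fin k → ℝ) (hy : y ⬝ᵥ (C⁻¹ *ᵥ y) ≤ 2 * ε / q) :
    (((C + Matrix.vecMulVec y y)⁻¹) ^ q).trace ≤
      ((C⁻¹) ^ q).trace - q * (1 - 2 * ε) * (y ⬝ᵥ (((C⁻¹) ^ (q + 1)) *ᵥ y)) := by
  have hY : (vecMulVec y y).PosSemidef := by
    simpa using Matrix.posSemidef_vecMulVec_self_star y
  have hCY : (C + vecMulVec y y).PosDef := hC.add_posSemidef hY
  have hA := hC.inv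
  have hB := hCY.inv
  have h1 : C⁻¹ * C = 1 := Matrix.nonsing_inv_mul _ (C.isUnit_iff_isUnit_det.1 hC.isUnit)
  have h2 : (C + vecMulVec y y) * (C + vecMulVec y y)⁻¹ = 1 :=
    Matrix.mul_nonsing_inv _ ((Matrix.isUnit_iff_isUnit_det _).1 hCY.isUnit)
  set A := C⁻¹ with hAd
  set B := (C + vecMulVec y y)⁻¹ with hBd
  have hBA : B = A - A * vecMulVec y y * B := by
    have : A * ((C + vecMulVec y y) * B) = A := by rw [h2, Matrix.mul_one]
    rw [Matrix.add_mul, Matrix.mul_add, ← Matrix.mul_assoc, h1, Matrix.one_mul,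
      ← Matrix.mul_assoc] at this
    exact eq_sub_of_add_eq this
  have hAt : Aᵀ = A := by simpa [Matrix.IsHermitian] using hA.1
  have hBt : Bᵀ = B := by simpa [Matrix.IsHermitian] using hB.1
  obtain ⟨l, w, hl, ha⟩ := quad_pow_aux A hA y
  have step : ∀ i m : ℕ, A ^ i * B ^ (m+1) =
      A ^ (i+1) * B ^ m - A ^ (i+1) * vecMulVec y y * B ^ (m+1) := by
    intro i m
    rw [pow_succ' B m]
    nth_rw 1 [hBA]
    rw [pow_succ A i]
    noncomm_ring
  clear_value A B
  set a : ℕ → ℝ := fun i => y ⬝ᵥ ((A ^ i) *ᵥ y) with had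
  set c : ℕ → ℕ → ℝ := fun i m => y ⬝ᵥ ((A ^ i * B ^ m) *ᵥ y) with hcd
  have a0 : ∀ i, 0 ≤ a i := by
    intro i
    simp only [had, ha]
    exact Finset.sum_nonneg fun j _ => by have := hl j; positivity
  have cheb : ∀ i m, a (i+1) * a (m+1) ≤ a 1 * a (i+m+1) := by
    intro i m
    simp only [had, ha]
    exact cheb_aux l w hl i m
  have c0 : ∀ i, c i 0 = a i := by intro i; simp [hcd, had]
  have cs : ∀ i m, c i (m+1) = c (i+1) m - a (i+1) * c 0 (m+1) := by
    intro i m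
    simp only [hcd, had]
    rw [step i m, Matrix.sub_mulVec, dotProduct_sub, quad_vec_aux, pow_zero, Matrix.one_mul]
  have hq0 : (0:ℝ) < q := by have : 0 < q := by omega
                             exact_mod_cast this
  have hs : q * a 1 ≤ 2 * ε := by
    have : a 1 ≤ 2 * ε / q := by simpa [had] using hy
    rw [le_div_iff₀ hq0] at this
    linarith
  have main : ∀ m, m ≤ q → ∀ i, a (i+m) * (1 - m * a 1) ≤ c i m ∧ c i m ≤ a (i+m) := by
    intro m
    induction m with
    | zero => intro _ i; simp [c0]
    | succ m ih =>
      intro hm i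
      have ih := ih (by omega)
      obtain ⟨l1, u1⟩ := ih (i+1)
      obtain ⟨l2, u2⟩ := ih 1
      have e0 := cs 0 m
      have hms : (m:ℝ) * a 1 ≤ 1 := by
        have : (m:ℝ) ≤ q := by exact_mod_cast (by omega : m ≤ q)
        have := mul_le_mul_of_nonneg_right this (a0 1)
        linarith
      have n2 : 0 ≤ c 1 m := le_trans (mul_nonneg (a0 _) (by linarith)) l2
      simp only [zero_add] at e0
      have e0' : c 0 (m+1) * (1 + a 1) = c 1 m := by linarith
      have s0 := a0 1
      have n3 : 0 ≤ c 0 (m+1) := by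
        by_contra h
        push Not at h
        nlinarith
      have n4 : c 0 (m+1) ≤ a (m+1) := by
        rw [add_comm 1 m] at u2
        nlinarith
      have n5 : 0 ≤ a (i+1) * c 0 (m+1) := mul_nonneg (a0 _) n3
      have n6 : a (i+1) * c 0 (m+1) ≤ a 1 * a (i+m+1) :=
        (mul_le_mul_of_nonneg_left n4 (a0 _)).trans (cheb i m)
      rw [cs i m]
      rw [show i + 1 + m = i + m + 1 by ring] at l1 u1
      rw [show i + (m + 1) = i + m + 1 by ring]
      push_cast
      constructor <;> linarith
  have tr : ∀ m, m ≤ q → ∀ i, (A ^ i * B ^ m).trace ≤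
      (A ^ (i+m)).trace - m * (1 - 2 * ε) * a (i+m+1) := by
    intro m
    induction m with
    | zero => intro _ i; simp
    | succ m ih =>
      intro hm i
      have h := ih (by omega) (i+1)
      have hc := (main (m+1) hm (i+1)).1
      have e : (A ^ (i+1) * vecMulVec y y * B ^ (m+1)).trace = c (i+1) (m+1) := by
        simp only [hcd]
        rw [Matrix.trace_mul_comm, ← Matrix.mul_assoc, Matrix.mul_vecMulVec,
          Matrix.trace_vecMulVec, dotProduct_comm, Matrix.dotProduct_mulVec,
          ← Matrix.mulVec_transpose, dotProduct_comm, Matrix.transpose_mul,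
          Matrix.transpose_pow, Matrix.transpose_pow, hAt, hBt]
      rw [step i m, Matrix.trace_sub, e]
      rw [show i + 1 + m = i + m + 1 by ring] at h
      rw [show i + 1 + (m + 1) = i + m + 1 + 1 by ring] at hc
      rw [show i + (m + 1) = i + m + 1 by ring]
      have hms : ((m+1:ℕ):ℝ) * a 1 ≤ 2 * ε := by
        have : ((m+1:ℕ):ℝ) ≤ q := by exact_mod_cast hm
        have := mul_le_mul_of_nonneg_right this (a0 1)
        linarith
      have := mul_le_mul_of_nonneg_left hms (a0 (i+m+1+1))
      push_cast at *
      linarith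
  have := tr q le_rfl 0
  simpa [had] using this
end

section
/- Let q ≥ 10 be an integer and 0 < ε ≤ 1/20. Let Y be a real symmetric positive definite n×n matrix, let M̄ be a real symmetric positive semidefinite n×n matrix, and let w ∈ ℝ^n satisfy w^T Y^{-1} w ≤ 2ε/q. Then Y − ww^T is invertible and tr[(Y − ww^T)^{-1} M̄] ≤ tr[Y^{-1} M̄] + (1 − 2ε/q)^{-1}·w^T Y^{-1} M̄ Y^{-1} w. -/
open Matrix

/-- Let `q ≥ 10`, `0 < ε ≤ 1/20`, `Y` real symmetric positive definite,
`M̄` real symmetric positive semidefinite, and `w` with `wᵀ Y⁻¹ w ≤ 2ε/q`. Then `Y − wwᵀ`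
is invertible and
`tr[(Y − wwᵀ)⁻¹ M̄] ≤ tr[Y⁻¹ M̄] + (1 − 2ε/q)⁻¹ · wᵀ Y⁻¹ M̄ Y⁻¹ w`. -/
theorem stmt_10 {n : ℕ} (q : ℕ) (hq : 10 ≤ q)
    (ε : ℝ) (hε0 : 0 < ε) (hε : ε ≤ 1 / 20)
    (Y : Matrix (Fin n) (Fin n) ℝ) (hY : Y.PosDef)
    (M : Matrix (Fin n) (Fin n) ℝ) (hM : M.PosSemidef)
    (w : Fin n → ℝ) (hw : w ⬝ᵥ (Y⁻¹ *ᵥ w) ≤ 2 * ε / q) :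
    IsUnit (Y - Matrix.vecMulVec w w).det ∧
    ((Y - Matrix.vecMulVec w w)⁻¹ * M).trace ≤
      (Y⁻¹ * M).trace + (1 - 2 * ε / q)⁻¹ * (w ⬝ᵥ ((Y⁻¹ * M * Y⁻¹) *ᵥ w)) := by
  have hYu : IsUnit Y.det := isUnit_iff_ne_zero.mpr hY.det_pos.ne'
  have hsym : (Y⁻¹)ᵀ = Y⁻¹ := by
    have h := hY.inv.isHermitian
    simpa [Matrix.IsHermitian, Matrix.conjTranspose_eq_transpose_of_trivial] using h
  set u := Y⁻¹ *ᵥ w with hu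
  have hYuw : Y *ᵥ u = w := by
    rw [hu, Matrix.mulVec_mulVec, Matrix.mul_nonsing_inv _ hYu, Matrix.one_mulVec]
  have hwY : w ᵥ* Y⁻¹ = u := by
    rw [hu, ← Matrix.mulVec_transpose, hsym]
  have hq0 : (10 : ℝ) ≤ q := by exact_mod_cast hq
  have hlt : 2 * ε / q < 1 := by
    rw [div_lt_one (by linarith)]; linarith
  have hpos : 0 < 1 - w ⬝ᵥ u := by linarith
  have hmul : (Y - Matrix.vecMulVec w w) *
      (Y⁻¹ + (1 - w ⬝ᵥ u)⁻¹ • Matrix.vecMulVec u u) = 1 := by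
    rw [Matrix.mul_add, Matrix.sub_mul, Matrix.mul_nonsing_inv _ hYu, Matrix.vecMulVec_mul, hwY,
      Matrix.mul_smul, Matrix.sub_mul, Matrix.mul_vecMulVec, hYuw,
      Matrix.vecMulVec_mul_vecMulVec]
    ext i j
    simp only [Matrix.add_apply, Matrix.sub_apply, Matrix.smul_apply, Matrix.vecMulVec_apply,
      Pi.smul_apply, smul_eq_mul, MulOpposite.smul_eq_mul_unop, MulOpposite.unop_op]
    field_simp
    ring
  have hinv := Matrix.inv_eq_right_inv hmul
  refine ⟨Matrix.isUnit_det_of_right_inverse hmul, ?_⟩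
  have hquad : w ⬝ᵥ ((Y⁻¹ * M * Y⁻¹) *ᵥ w) = u ⬝ᵥ (M *ᵥ u) := by
    rw [← Matrix.mulVec_mulVec, ← hu, ← Matrix.mulVec_mulVec, Matrix.dotProduct_mulVec, hwY]
  have hnn : 0 ≤ u ⬝ᵥ (M *ᵥ u) := by
    simpa using hM.dotProduct_mulVec_nonneg u
  have htr : (Matrix.vecMulVec u u * M).trace = u ⬝ᵥ (M *ᵥ u) := by
    rw [Matrix.vecMulVec_mul, Matrix.trace_vecMulVec, Matrix.dotProduct_mulVec, dotProduct_comm]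
  rw [hinv, hquad, Matrix.add_mul, Matrix.trace_add, Matrix.smul_mul, Matrix.trace_smul, htr,
    smul_eq_mul]
  have hc : (1 - w ⬝ᵥ u)⁻¹ ≤ (1 - 2 * ε / q)⁻¹ :=
    inv_anti₀ (by linarith) (by linarith)
  have := mul_le_mul_of_nonneg_right hc hnn
  linarith
end

section
/- Let q ≥ 10 be an integer and 0 < ε ≤ 1/20. Let C be a real symmetric positive definite k×k matrix and let y ∈ ℝ^k satisfy y^T C^{-1} y ≤ 2ε/q. Then tr[(C + yy^T)^{-1}] ≤ tr[C^{-1}] − (1 + 2ε/q)^{-1}·y^T C^{-2} y. -/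
open Matrix

/-- Let `q ≥ 10`, `0 < ε ≤ 1/20`, `C` a real symmetric positive definite
`k × k` matrix and `y` with `yᵀ C⁻¹ y ≤ 2ε/q`. Then
`tr[(C + yyᵀ)⁻¹] ≤ tr[C⁻¹] − (1 + 2ε/q)⁻¹ · yᵀ C^{-2} y`. -/
theorem stmt_11 {k : ℕ} (q : ℕ) (hq : 10 ≤ q)
    (ε : ℝ) (hε0 : 0 < ε) (hε : ε ≤ 1 / 20)
    (C : Matrix (Fin k) (Fin k) ℝ) (hC : C.PosDef)
    (y : Fin k → ℝ) (hy : y ⬝ᵥ (C⁻¹ *ᵥ y) ≤ 2 * ε / q) :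
    ((C + Matrix.vecMulVec y y)⁻¹).trace ≤
      (C⁻¹).trace - (1 + 2 * ε / q)⁻¹ * (y ⬝ᵥ (((C⁻¹) ^ 2) *ᵥ y)) := by
  have hdet : IsUnit C.det := (Matrix.isUnit_iff_isUnit_det C).1 hC.isUnit
  have hCi : C⁻¹.PosDef := hC.inv
  have hs : 0 ≤ y ⬝ᵥ (C⁻¹ *ᵥ y) := by
    simpa using hCi.posSemidef.dotProduct_mulVec_nonneg y
  have hsym : C⁻¹ᵀ = C⁻¹ := by
    simpa [Matrix.IsHermitian, Matrix.conjTranspose_eq_transpose_of_trivial] using hCi.isHermitian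
  have hCz : C *ᵥ (C⁻¹ *ᵥ y) = y := by
    rw [Matrix.mulVec_mulVec, Matrix.mul_nonsing_inv _ hdet, Matrix.one_mulVec]
  have hyC : y ᵥ* C⁻¹ = C⁻¹ *ᵥ y := by
    rw [← Matrix.mulVec_transpose, hsym]
  have hsq : y ⬝ᵥ (((C⁻¹) ^ 2) *ᵥ y) = (C⁻¹ *ᵥ y) ⬝ᵥ (C⁻¹ *ᵥ y) := by
    rw [pow_two, ← Matrix.mulVec_mulVec, Matrix.dotProduct_mulVec, hyC]
  rw [hsq]
  have hmul1 : C * C⁻¹ = 1 := Matrix.mul_nonsing_inv _ hdet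
  generalize hz : C⁻¹ *ᵥ y = z at *
  generalize hss : y ⬝ᵥ z = s at *
  have hinv : (C + Matrix.vecMulVec y y)⁻¹ = C⁻¹ - (1 + s)⁻¹ • Matrix.vecMulVec z z := by
    apply Matrix.inv_eq_right_inv
    rw [add_mul, mul_sub, mul_sub, hmul1, Matrix.mul_smul, Matrix.mul_smul,
      Matrix.mul_vecMulVec, hCz, Matrix.vecMulVec_mul, hyC, Matrix.vecMulVec_mul_vecMulVec, hss]
    ext i j
    simp [Matrix.vecMulVec_apply]
    field_simp
    ring
  have hzz : 0 ≤ z ⬝ᵥ z := by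
    simpa using dotProduct_star_self_nonneg z
  rw [hinv, Matrix.trace_sub, Matrix.trace_smul, Matrix.trace_vecMulVec, smul_eq_mul]
  have : (1 + 2 * ε / q)⁻¹ ≤ (1 + s)⁻¹ := by
    apply inv_anti₀ <;> linarith
  nlinarith [mul_le_mul_of_nonneg_right this hzz]
end

section
/- Let n ≥ k ≥ 1, let X be a real symmetric n×n matrix with 0 ⪯ X ⪯ I, and let V be a real n×k matrix with V^T V = I_k; write P = V V^T and assume X commutes with P. Assume S := V^T (I − X) V is positive definite and set Z := V S^{-1/2} V^T, where S^{-1/2} is the inverse of the positive-definite square root of S. Let λ* > 0 be such that u^T X u ≥ (λ*/2)·u^T u for every u ∈ ℝ^n with V^T u = 0. Let A be a real symmetric n×n matrix with A − X positive semidefinite and A ⪯ θ_max·I for some θ_max > 0, set B := Z (A − X) Z, and assume V^T B V ⪰ θ_min·I_k for some θ_min with 0 < θ_min ≤ 1. Then the smallest eigenvalue of A satisfies λ_1(A) ≥ θ_min·(λ*/2) / (√(λ*/2) + √θ_min + √θ_max)². -/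
open Matrix
open scoped MatrixOrder

lemma quad_psd {m : ℕ} {M : Matrix (Fin m) (Fin m) ℝ} (h : M.PosSemidef) (v : Fin m → ℝ) :
    0 ≤ v ⬝ᵥ (M *ᵥ v) := by
  simpa using h.dotProduct_mulVec_nonneg v

lemma scalar_fin {α β q m t M : ℝ} (hm : 0 < m) (ht : 0 < t) (hM : 0 < M)
    (hq0 : 0 ≤ q) (hq : m * β ≤ q)
    (h : ∀ s : ℝ, 0 < s → s * (t * α) ≤ (1 + s) * (s * q + M * β)) :
    t * m / (√m + √t + √M) ^ 2 * (α + β) ≤ q := by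
  obtain ⟨m', hm', rfl⟩ : ∃ r, 0 < r ∧ m = r ^ 2 := ⟨√m, by positivity, by rw [Real.sq_sqrt hm.le]⟩
  obtain ⟨t', ht', rfl⟩ : ∃ r, 0 < r ∧ t = r ^ 2 := ⟨√t, by positivity, by rw [Real.sq_sqrt ht.le]⟩
  obtain ⟨M', hM', rfl⟩ : ∃ r, 0 < r ∧ M = r ^ 2 := ⟨√M, by positivity, by rw [Real.sq_sqrt hM.le]⟩
  rw [Real.sqrt_sq hm'.le, Real.sqrt_sq ht'.le, Real.sqrt_sq hM'.le]
  have h1 := h (M' / m') (by positivity)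
  have h2 : m' * (t' ^ 2 * α) ≤ (m' + M') * (q + M' * m' * β) := by
    have := mul_le_mul_of_nonneg_left h1 (show 0 ≤ m' ^ 2 / M' by positivity)
    have e1 : m' ^ 2 / M' * (M' / m' * (t' ^ 2 * α)) = m' * (t' ^ 2 * α) := by field_simp
    have e2 : m' ^ 2 / M' * ((1 + M' / m') * (M' / m' * q + M' ^ 2 * β))
        = (m' + M') * (q + M' * m' * β) := by field_simp
    rwa [e1, e2] at this
  rw [div_mul_eq_mul_div, div_le_iff₀ (by positivity)]
  have hM'' : (m' + M') * M' * (m' ^ 2 * β) ≤ (m' + M') * M' * q :=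
    mul_le_mul_of_nonneg_left hq (by positivity)
  have h3 : m' ^ 2 * (t' ^ 2 * α) ≤ (m' + M') ^ 2 * q := by
    have := mul_le_mul_of_nonneg_left h2 hm'.le
    linarith
  have h4 : t' ^ 2 * (m' ^ 2 * β) ≤ t' ^ 2 * q := mul_le_mul_of_nonneg_left hq (by positivity)
  have h5 : 0 ≤ (m' + M') * t' * q := mul_nonneg (by positivity) hq0
  linarith

lemma key_V {n k : ℕ}
    (X A Z B : Matrix (Fin n) (Fin n) ℝ)
    (hXI : ((1 : Matrix (Fin n) (Fin n) ℝ) - X).PosSemidef)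
    (V : Matrix (Fin n) (Fin k) ℝ) (hV : Vᵀ * V = 1)
    (hS : (Vᵀ * ((1 : Matrix (Fin n) (Fin n) ℝ) - X) * V).PosDef)
    (t : ℝ)
    (hZ : Z = V * (CFC.sqrt (Vᵀ * ((1 : Matrix (Fin n) (Fin n) ℝ) - X) * V))⁻¹ * Vᵀ)
    (hB : B = Z * (A - X) * Z)
    (hBmin : (Vᵀ * B * V - t • (1 : Matrix (Fin k) (Fin k) ℝ)).PosSemidef) :
    (Vᵀ * (A - X) * V - t • (Vᵀ * ((1 : Matrix (Fin n) (Fin n) ℝ) - X) * V)).PosSemidef := by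
  set S := Vᵀ * ((1 : Matrix (Fin n) (Fin n) ℝ) - X) * V with hSdef
  set Q := CFC.sqrt S with hQ
  have hQQ : Q * Q = S := CFC.sqrt_mul_sqrt_self S hS.posSemidef.nonneg
  have hQh : Qᴴ = Q := (CFC.sqrt_nonneg S).posSemidef.isHermitian
  have hdet : IsUnit Q.det := by
    have h1 : S.det ≠ 0 := hS.det_pos.ne'
    rw [← hQQ, det_mul] at h1
    exact isUnit_iff_ne_zero.mpr (left_ne_zero_of_mul h1)
  have hc := hBmin.conjTranspose_mul_mul_same Q
  rw [hQh] at hc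
  have e : Vᵀ * B * V = Q⁻¹ * (Vᵀ * (A - X) * V) * Q⁻¹ := by
    rw [hB, hZ]
    calc _ = (Vᵀ * V) * Q⁻¹ * (Vᵀ * (A - X) * V) * Q⁻¹ * (Vᵀ * V) := by
          simp only [Matrix.mul_assoc]
      _ = _ := by rw [hV]; simp
  convert hc using 1
  rw [e]
  generalize Vᵀ * (A - X) * V = C
  rw [Matrix.mul_sub, Matrix.sub_mul]
  congr 1
  · calc _ = (Q * Q⁻¹) * C * (Q⁻¹ * Q) := by
          rw [mul_nonsing_inv _ hdet, nonsing_inv_mul _ hdet]; simp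
      _ = _ := by simp only [Matrix.mul_assoc]
  · simp [hQQ]

/-- (Approximation guarantee of the subgraph sparsifier.)
Let `0 ⪯ X ⪯ I` be symmetric, let `V` be an `n × k` matrix with `Vᵀ V = I_k` whose associated
projection `P = V Vᵀ` commutes with `X`, assume `S = Vᵀ (I − X) V` is positive definite and
set `Z = V S^{-1/2} Vᵀ` (with `S^{-1/2}` the inverse of the positive-definite square root of
`S`). Suppose `uᵀ X u ≥ (λ*/2) uᵀ u` whenever `Vᵀ u = 0`. Let `A` be symmetric with
`A − X ⪰ 0` and `A ⪯ θ_max I` (`θ_max > 0`), let `B = Z (A − X) Z`, and assume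
`Vᵀ B V ⪰ θ_min I_k` with `0 < θ_min ≤ 1`. Then
`λ_min(A) ≥ θ_min (λ*/2) / (√(λ*/2) + √θ_min + √θ_max)²`, i.e. `A − c I ⪰ 0` for that
constant `c`. -/
theorem stmt_15 {n k : ℕ} (hk : 1 ≤ k) (hkn : k ≤ n)
    (X : Matrix (Fin n) (Fin n) ℝ) (hX : X.PosSemidef)
    (hXI : ((1 : Matrix (Fin n) (Fin n) ℝ) - X).PosSemidef)
    (V : Matrix (Fin n) (Fin k) ℝ) (hV : Vᵀ * V = 1)
    (hcomm : X * (V * Vᵀ) = (V * Vᵀ) * X)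
    (hS : (Vᵀ * ((1 : Matrix (Fin n) (Fin n) ℝ) - X) * V).PosDef)
    (lam : ℝ) (hlam : 0 < lam)
    (hlow : ∀ u : Fin n → ℝ, Vᵀ *ᵥ u = 0 →
      lam / 2 * (u ⬝ᵥ u) ≤ u ⬝ᵥ (X *ᵥ u))
    (A : Matrix (Fin n) (Fin n) ℝ) (hA : A.IsHermitian)
    (hAX : (A - X).PosSemidef)
    (θmax : ℝ) (hθmax : 0 < θmax)
    (hAmax : (θmax • (1 : Matrix (Fin n) (Fin n) ℝ) - A).PosSemidef)
    (θmin : ℝ) (hθmin0 : 0 < θmin) (hθmin1 : θmin ≤ 1)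
    (Z : Matrix (Fin n) (Fin n) ℝ)
    (hZ : Z = V * (CFC.sqrt (Vᵀ * ((1 : Matrix (Fin n) (Fin n) ℝ) - X) * V))⁻¹ * Vᵀ)
    (B : Matrix (Fin n) (Fin n) ℝ) (hB : B = Z * (A - X) * Z)
    (hBmin : (Vᵀ * B * V - θmin • (1 : Matrix (Fin k) (Fin k) ℝ)).PosSemidef) :
    (A - (θmin * (lam / 2) /
        (Real.sqrt (lam / 2) + Real.sqrt θmin + Real.sqrt θmax) ^ 2) •
      (1 : Matrix (Fin n) (Fin n) ℝ)).PosSemidef := by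
  have hK := key_V X A Z B hXI V hV hS θmin hZ hB hBmin
  refine PosSemidef.of_dotProduct_mulVec_nonneg (hA.sub (by simp [IsHermitian])) fun x => ?_
  simp only [star_trivial, sub_mulVec, smul_mulVec, one_mulVec, dotProduct_sub, dotProduct_smul,
    smul_eq_mul, sub_nonneg]
  have symm : ∀ {M : Matrix (Fin n) (Fin n) ℝ}, M.IsHermitian → ∀ u v : Fin n → ℝ,
      u ⬝ᵥ (M *ᵥ v) = v ⬝ᵥ (M *ᵥ u) := by
    intro M hM u v
    have : Mᵀ = M := by simpa [IsHermitian] using hM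
    rw [dotProduct_mulVec, ← mulVec_transpose, this, dotProduct_comm]
  obtain ⟨w, hw⟩ : ∃ w, w = Vᵀ *ᵥ x := ⟨_, rfl⟩
  obtain ⟨b, hb⟩ : ∃ b, b = x - V *ᵥ w := ⟨_, rfl⟩
  have hVb : Vᵀ *ᵥ b = 0 := by
    rw [hb, mulVec_sub, mulVec_mulVec, hV, one_mulVec, hw, sub_self]
  have hx : x = V *ᵥ w + b := by rw [hb]; abel
  have pull : ∀ (u : Fin k → ℝ) (v : Fin n → ℝ), (V *ᵥ u) ⬝ᵥ v = u ⬝ᵥ (Vᵀ *ᵥ v) := by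
    intro u v
    rw [dotProduct_mulVec, vecMul_transpose]
  have haa : (V *ᵥ w) ⬝ᵥ (V *ᵥ w) = w ⬝ᵥ w := by
    rw [pull, mulVec_mulVec, hV, one_mulVec]
  have hab : (V *ᵥ w) ⬝ᵥ b = 0 := by rw [pull, hVb, dotProduct_zero]
  have haXb : (V *ᵥ w) ⬝ᵥ (X *ᵥ b) = 0 := by
    have : Vᵀ * X = Vᵀ * X * V * Vᵀ := by
      calc Vᵀ * X = (Vᵀ * V) * Vᵀ * X := by rw [hV]; simp
        _ = Vᵀ * ((V * Vᵀ) * X) := by simp only [Matrix.mul_assoc]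
        _ = _ := by rw [← hcomm]; simp only [Matrix.mul_assoc]
    rw [pull, mulVec_mulVec, this, ← mulVec_mulVec, hVb]; simp
  have hKw := quad_psd hK w
  have q1 := quad_psd hAX x
  have q2 := quad_psd hXI (V *ᵥ w)
  have q3 := quad_psd hX (V *ᵥ w)
  have q4 := quad_psd hAmax b
  have q5 := hlow b hVb
  have hA0 : ∀ v, 0 ≤ v ⬝ᵥ (A *ᵥ v) := fun v => by
    have := quad_psd (hAX.add hX) v
    simpa using this
  simp only [sub_mulVec, smul_mulVec, one_mulVec, dotProduct_sub, dotProduct_smul,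
    smul_eq_mul, ← mulVec_mulVec, ← pull] at hKw q1 q2 q4
  have hXx : x ⬝ᵥ (X *ᵥ x) = (V *ᵥ w) ⬝ᵥ (X *ᵥ (V *ᵥ w)) + b ⬝ᵥ (X *ᵥ b) := by
    have := symm hX.isHermitian b (V *ᵥ w)
    rw [hx]
    simp only [mulVec_add, dotProduct_add, add_dotProduct]
    linarith
  have hxx : x ⬝ᵥ x = (V *ᵥ w) ⬝ᵥ (V *ᵥ w) + b ⬝ᵥ b := by
    have := dotProduct_comm b (V *ᵥ w)
    rw [hx]
    simp only [dotProduct_add, add_dotProduct]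
    linarith
  rw [hxx]
  refine scalar_fin (by positivity) hθmin0 hθmax (hA0 x) (by linarith) fun s hs => ?_
  have hta : θmin * ((V *ᵥ w) ⬝ᵥ (V *ᵥ w)) ≤ (V *ᵥ w) ⬝ᵥ (A *ᵥ (V *ᵥ w)) := by
    nlinarith
  have hsq := hA0 (s • x + b)
  have hAa : (V *ᵥ w) ⬝ᵥ (A *ᵥ (V *ᵥ w)) =
      x ⬝ᵥ (A *ᵥ x) - 2 * (x ⬝ᵥ (A *ᵥ b)) + b ⬝ᵥ (A *ᵥ b) := by
    have := symm hA b x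
    have e : V *ᵥ w = x - b := by rw [hx]; abel
    rw [e]
    simp only [mulVec_sub, dotProduct_sub, sub_dotProduct]
    linarith
  have hs2 : 0 ≤ s ^ 2 * (x ⬝ᵥ (A *ᵥ x)) + 2 * s * (x ⬝ᵥ (A *ᵥ b)) + b ⬝ᵥ (A *ᵥ b) := by
    have := symm hA b x
    simp only [mulVec_add, mulVec_smul, dotProduct_add, add_dotProduct, smul_dotProduct,
      dotProduct_smul, smul_eq_mul, this] at hsq
    linarith
  have h1 := mul_le_mul_of_nonneg_left hta hs.le
  have h2 : (1 + s) * (b ⬝ᵥ (A *ᵥ b)) ≤ (1 + s) * (θmax * (b ⬝ᵥ b)) :=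
    mul_le_mul_of_nonneg_left (by linarith) (by linarith)
  rw [hAa] at h1
  linarith
end

section
/- Let G be an undirected weighted graph on n vertices with nonnegative edge weights and let R be an undirected weighted graph on the same n vertices with nonnegative edge weights and at most k edges, where n ≥ k + 2. Then λ_2(L_G + L_R) ≤ λ_{k+2}(L_G), where eigenvalues are listed in nondecreasing order. In particular, the maximum algebraic connectivity λ_OPT achievable by adding any set of k weighted edges to G is at most λ_{k+2}(L_G). -/
open Matrix

theorem aux_basis {n : ℕ} (M : Matrix (Fin n) (Fin n) ℝ) (hM : M.IsHermitian) :
    Monotone (sortedEig M) ∧ ∃ b : Fin n → Fin n → ℝ,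
      (∀ x : Fin n → ℝ, x ⬝ᵥ x = ∑ i, (b i ⬝ᵥ x) ^ 2) ∧
      (∀ x : Fin n → ℝ, x ⬝ᵥ (M *ᵥ x) = ∑ i, sortedEig M i * (b i ⬝ᵥ x) ^ 2) := by
  have hs : sortedEig M = hM.eigenvalues ∘ Tuple.sort hM.eigenvalues := by
    rw [sortedEig, dif_pos hM]
  refine ⟨hs ▸ Tuple.monotone_sort _, ?_⟩
  have key : ∀ x y : Fin n → ℝ, x ⬝ᵥ y = ∑ i,
      ((hM.eigenvectorBasis i).ofLp ⬝ᵥ x) * ((hM.eigenvectorBasis i).ofLp ⬝ᵥ y) := by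
    intro x y
    have h := hM.eigenvectorBasis.sum_inner_mul_inner (WithLp.toLp 2 x) (WithLp.toLp 2 y)
    simp only [EuclideanSpace.inner_eq_star_dotProduct, star_trivial] at h
    rw [dotProduct_comm x y, ← h]
    refine Finset.sum_congr rfl fun i _ => ?_
    rw [dotProduct_comm y]
  refine ⟨fun i => (hM.eigenvectorBasis (Tuple.sort hM.eigenvalues i)).ofLp, ?_, ?_⟩
  · intro x
    rw [key x x, ← Equiv.sum_comp (Tuple.sort hM.eigenvalues)]
    exact Finset.sum_congr rfl fun i _ => by ring
  · intro x
    rw [key x, ← Equiv.sum_comp (Tuple.sort hM.eigenvalues), hs]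
    refine Finset.sum_congr rfl fun i _ => ?_
    have hT : Mᵀ = M := by simpa [conjTranspose_eq_transpose_of_trivial] using hM.eq
    rw [dotProduct_mulVec, ← mulVec_transpose, hT, hM.mulVec_eigenvectorBasis, smul_dotProduct]
    simp only [Function.comp, smul_eq_mul]
    ring

/-- Let `G` be an undirected weighted graph on `n` vertices with nonnegative
weights (Laplacian `L_G`), and let `R` be an undirected weighted graph on the same vertices
with nonnegative weights and at most `k` edges (Laplacian `L_R = Σ_{e ∈ E_R} w_R(e) L_e`),
where `n ≥ k + 2`. Then `λ_2(L_G + L_R) ≤ λ_{k+2}(L_G)` (eigenvalues in nondecreasing order).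
In particular, the maximum algebraic connectivity achievable by adding any `k` weighted edges
to `G` is at most `λ_{k+2}(L_G)`. -/
theorem stmt_16 {n k : ℕ} (hn : k + 2 ≤ n)
    (w : Fin n → Fin n → ℝ)
    (hsymm : ∀ u v, w u v = w v u)
    (hnonneg : ∀ u v, 0 ≤ w u v)
    (hloop : ∀ u, w u u = 0)
    (LG : Matrix (Fin n) (Fin n) ℝ) (hLGsymm : LG.IsSymm)
    (hLG : ∀ x : Fin n → ℝ,
      x ⬝ᵥ (LG *ᵥ x) = (1 / 2) * ∑ u, ∑ v, w u v * (x u - x v) ^ 2)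
    (ER : Finset (Fin n × Fin n)) (hER : ∀ e ∈ ER, e.1 ≠ e.2)
    (hcard : ER.card ≤ k)
    (wR : Fin n × Fin n → ℝ) (hwR : ∀ e, 0 ≤ wR e) :
    sortedEig (LG + ∑ e ∈ ER, wR e • edgeLap e) ⟨1, by omega⟩ ≤
      sortedEig LG ⟨k + 1, by omega⟩ := by
  have hA : LG.IsHermitian := by
    rw [IsHermitian, conjTranspose_eq_transpose_of_trivial]; exact hLGsymm
  have hB : (LG + ∑ e ∈ ER, wR e • edgeLap e).IsHermitian := by
    rw [IsHermitian, conjTranspose_eq_transpose_of_trivial, transpose_add, transpose_sum,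
      hLGsymm.eq]
    congr 1
    refine Finset.sum_congr rfl fun e _ => ?_
    rw [transpose_smul, edgeLap, transpose_vecMulVec]
  obtain ⟨mA, a, ha1, ha2⟩ := aux_basis _ hA
  obtain ⟨mB, b, hb1, hb2⟩ := aux_basis _ hB
  set B := LG + ∑ e ∈ ER, wR e • edgeLap e with hBdef
  let ι := Unit ⊕ ER ⊕ {i : Fin n // k + 1 < i.val}
  let V : Matrix ι (Fin n) ℝ := Matrix.of
    (Sum.elim (fun _ => b ⟨0, by omega⟩) (Sum.elim (fun e => edgeVec e.1) (fun i => a i.1)))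
  have hcardι : Fintype.card {i : Fin n // k + 1 < i.val} = n - (k + 2) := by
    have h := Fin.card_Ioi (⟨k + 1, by omega⟩ : Fin n)
    rw [Fintype.card_subtype]
    have : (Finset.univ.filter fun i : Fin n => k + 1 < i.val)
        = Finset.Ioi (⟨k + 1, by omega⟩ : Fin n) := by
      ext i; simp [Fin.lt_def]
    rw [this, h]
    simp only
    omega
  have hlt : Module.finrank ℝ (ι → ℝ) < Module.finrank ℝ (Fin n → ℝ) := by
    rw [Module.finrank_fintype_fun_eq_card, Module.finrank_fintype_fun_eq_card]
    simp only [ι, Fintype.card_sum, hcardι, Fintype.card_coe, Fintype.card_fin, Fintype.card_unit]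
    omega
  obtain ⟨x, hx, hx0⟩ := (Submodule.ne_bot_iff _).1
    (LinearMap.ker_ne_bot_of_finrank_lt (f := V.mulVecLin) hlt)
  have hV : ∀ j : ι, V j ⬝ᵥ x = 0 := fun j => congrFun (LinearMap.mem_ker.1 hx) j
  have h0 : b ⟨0, by omega⟩ ⬝ᵥ x = 0 := hV (Sum.inl ())
  have hE : ∀ e ∈ ER, edgeVec e ⬝ᵥ x = 0 := fun e he => hV (Sum.inr (Sum.inl ⟨e, he⟩))
  have hI : ∀ i : Fin n, k + 1 < i.val → a i ⬝ᵥ x = 0 :=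
    fun i hi => hV (Sum.inr (Sum.inr ⟨i, hi⟩))
  have hq : x ⬝ᵥ (B *ᵥ x) = x ⬝ᵥ (LG *ᵥ x) := by
    have : (∑ e ∈ ER, wR e • edgeLap e) *ᵥ x = 0 := by
      rw [sum_mulVec]
      refine Finset.sum_eq_zero fun e he => ?_
      rw [smul_mulVec, edgeLap, vecMulVec_mulVec, hE e he]
      simp
    rw [hBdef, add_mulVec, this, add_zero]
  have hup : x ⬝ᵥ (LG *ᵥ x) ≤ sortedEig LG ⟨k + 1, by omega⟩ * (x ⬝ᵥ x) := by
    rw [ha2, ha1, Finset.mul_sum]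
    refine Finset.sum_le_sum fun i _ => ?_
    by_cases hi : k + 1 < i.val
    · simp [hI i hi]
    · exact mul_le_mul_of_nonneg_right (mA (by rw [Fin.le_def]; simp only; omega)) (sq_nonneg _)
  have hlo : sortedEig B ⟨1, by omega⟩ * (x ⬝ᵥ x) ≤ x ⬝ᵥ (B *ᵥ x) := by
    rw [hb2, hb1, Finset.mul_sum]
    refine Finset.sum_le_sum fun i _ => ?_
    by_cases hi : i = ⟨0, by omega⟩
    · rw [hi, h0]; simp
    · have : i.val ≠ 0 := fun h => hi (Fin.ext h)
      exact mul_le_mul_of_nonneg_right (mB (by rw [Fin.le_def]; simp only; omega)) (sq_nonneg _)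
  have hpos : 0 < x ⬝ᵥ x := by
    refine lt_of_le_of_ne (Finset.sum_nonneg fun i _ => mul_self_nonneg _) fun h => hx0 ?_
    exact dotProduct_self_eq_zero.1 h.symm
  exact le_of_mul_le_mul_right (by linarith) hpos
end
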